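/- arXiv:2306.10278 — 3 statements merged into one kernel-verified Lean document; each statement's English description precedes it below -/
import Mathlib

section
/- Let F: ℝ^d → ℝ be L-smooth and bounded below by F*. On a probability space with filtration (𝔉_t), at each step t receive 𝔉_t-measurable g_t, g'_t with E[g_t | 𝔉_{t−1}] = E[g'_t | 𝔉_{t−1}] = ∇F(x_t), E[g_{t,j} g'_{t,j} | 𝔉_{t−1}] = (∂_j F(x_t))², E[(g_{t,j} − ∂_j F(x_t))² | 𝔉_{t−1}] ≤ σ_j², and |g_{t,j}| ≤ G_j, |g'_{t,j}| ≤ G_j almost surely, for each coordinate j. Fix α > 0 and update x_{t+1,j} = x_{t,j} − η_{t,j} g_{t,j} with η_{t,j} = max{0, min{(α + Σ_{i=1}^{t−1} g_{i,j} g'_{i,j})/(L(α + Σ_{i=1}^{t−1} g_{i,j}²)), 2/L}}. Then: (i) for each j ∈ {1,…,d}, E[Σ_{t=1}^T (∂_j F(x_t))²] ≤ 2L(F(x₁) − F* + Σ_{i=1}^d (5G_i²/L)·ln(1 + G_i²T/α)) + √(2Lσ_j²T(F(x₁) − F* + dα/(2L))) + √(10σ_j²T·Σ_{i=1}^d G_i²·ln(1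 + G_i²T/α)) + (d−1)α; and (ii) with σ² = Σ_{j=1}^d σ_j², E[Σ_{t=1}^T ‖∇F(x_t)‖₂²] ≤ 2L(F(x₁) − F* + (5/L)·Σ_{i=1}^d G_i²·ln(1 + G_i²T/α)) + √(2Lσ²T(F(x₁) − F* + dα/(2L))) + √(10σ²T·Σ_{i=1}^d G_i²·ln(1 + G_i²T/α)). -/
open MeasureTheory
open scoped BigOperators

/-- clip -/
lemma sg_clip (L A B u : ℝ) (hL : 0 < L) (hA : 0 < A) (hu0 : 0 ≤ u) (hu2 : u ≤ 2 / L) :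
    0 ≤ (L * A * (max 0 (min (B / (L * A)) (2 / L))) - B) *
      (u - max 0 (min (B / (L * A)) (2 / L))) := by
  have hLA : 0 < L * A := by positivity
  have h2L : 0 < 2 / L := by positivity
  set q := B / (L * A) with hq
  have hB : B = L * A * q := by rw [hq]; field_simp
  rw [hB]
  have e : ∀ v : ℝ, (L * A * v - L * A * q) * (u - v) = L * A * ((v - q) * (u - v)) := by
    intro v; ring
  rw [e]
  apply mul_nonneg hLA.le
  rcases le_total q (2 / L) with h | h
  · rw [min_eq_left h]
    rcases le_total 0 q with h' | h'
    · rw [max_eq_right h']; simp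
    · rw [max_eq_left h']; apply mul_nonneg <;> linarith
  · rw [min_eq_right h, max_eq_right h2L.le]
    apply mul_nonneg_of_nonpos_of_nonpos <;> linarith

/-- step size -/
noncomputable def sgEta (L α : ℝ) (a b : ℕ → ℝ) (t : ℕ) : ℝ :=
  max 0 (min ((α + ∑ i ∈ Finset.Icc 1 (t - 1), a i * b i) /
            (L * (α + ∑ i ∈ Finset.Icc 1 (t - 1), (a i) ^ 2))) (2 / L))

lemma sgEta_nonneg (L α : ℝ) (a b : ℕ → ℝ) (t : ℕ) : 0 ≤ sgEta L α a b t := le_max_left _ _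

lemma sgEta_le (L α : ℝ) (hL : 0 < L) (a b : ℕ → ℝ) (t : ℕ) : sgEta L α a b t ≤ 2 / L :=
  max_le (by positivity) (min_le_right _ _)

lemma sg_regret (L α G : ℝ) (hL : 0 < L) (hα : 0 < α) (a b : ℕ → ℝ) (T : ℕ)
    (ha : ∀ t ∈ Finset.Icc 1 T, |a t| ≤ G) (hb : ∀ t ∈ Finset.Icc 1 T, |b t| ≤ G) :
    ∀ t ≤ T, ∀ u, 0 ≤ u → u ≤ 2 / L →
      ∑ i ∈ Finset.Icc 1 t, (-(sgEta L α a b i * (a i * b i))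
        + L / 2 * (sgEta L α a b i ^ 2 * a i ^ 2)) ≤
      ∑ i ∈ Finset.Icc 1 t, (-(u * (a i * b i)) + L / 2 * (u ^ 2 * a i ^ 2))
        + L * α / 2 * (u - 1 / L) ^ 2
        + 9 * G ^ 2 / (2 * L) * Real.log ((α + ∑ i ∈ Finset.Icc 1 t, a i ^ 2) / α) := by
  intro t
  induction t with
  | zero =>
    intro _ u _ _
    simp [hα.ne']
    positivity
  | succ t ih =>
    intro ht u hu0 hu2
    have iht := ih (by omega) (sgEta L α a b (t+1)) (sgEta_nonneg _ _ _ _ _)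
      (sgEta_le _ _ hL _ _ _)
    simp only [Finset.sum_Icc_succ_top (show 1 ≤ t + 1 by omega)]
    have hat := ha (t+1) (Finset.mem_Icc.2 ⟨by omega, ht⟩)
    have hbt := hb (t+1) (Finset.mem_Icc.2 ⟨by omega, ht⟩)
    have hS : 0 ≤ ∑ i ∈ Finset.Icc 1 t, a i ^ 2 := Finset.sum_nonneg fun i _ => sq_nonneg _
    have hclip := sg_clip L (α + ∑ i ∈ Finset.Icc 1 t, a i ^ 2)
      (α + ∑ i ∈ Finset.Icc 1 t, a i * b i) u hL (by positivity) hu0 hu2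
    have heta : sgEta L α a b (t+1) = max 0 (min ((α + ∑ i ∈ Finset.Icc 1 t, a i * b i) /
            (L * (α + ∑ i ∈ Finset.Icc 1 t, (a i) ^ 2))) (2 / L)) := by
      simp [sgEta]
    rw [← heta] at hclip
    have hη0 := sgEta_nonneg L α a b (t+1)
    have hη2 := sgEta_le L α hL a b (t+1)
    have hsum : ∀ v : ℝ, ∑ i ∈ Finset.Icc 1 t, (-(v * (a i * b i)) + L / 2 * (v ^ 2 * a i ^ 2))
        = -(v * ∑ i ∈ Finset.Icc 1 t, a i * b i)
          + L / 2 * (v ^ 2 * ∑ i ∈ Finset.Icc 1 t, a i ^ 2) := by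
      intro v
      rw [Finset.sum_add_distrib, Finset.sum_neg_distrib, Finset.mul_sum, Finset.mul_sum,
        Finset.mul_sum]
    rw [hsum] at iht ⊢
    generalize sgEta L α a b (t+1) = η at *
    generalize a (t+1) = p at *
    generalize b (t+1) = q at *
    generalize (∑ i ∈ Finset.Icc 1 t, a i ^ 2) = S at *
    generalize (∑ i ∈ Finset.Icc 1 t, a i * b i) = B at *
    set A := α + S with hA
    have hA0 : 0 < A := by positivity
    have hA' : α + (S + p ^ 2) = A + p ^ 2 := by rw [hA]; ring
    rw [hA']
    have hAp : 0 < A + p ^ 2 := by positivity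
    -- log bound
    have hlog : p ^ 2 / (A + p ^ 2) ≤ Real.log ((A + p ^ 2) / α) - Real.log (A / α) := by
      have h1 := Real.one_sub_inv_le_log_of_pos (show 0 < (A + p^2) / A by positivity)
      rw [Real.log_div hAp.ne' hα.ne', Real.log_div hA0.ne' hα.ne']
      rw [Real.log_div hAp.ne' hA0.ne'] at h1
      have : 1 - ((A + p ^ 2) / A)⁻¹ = p ^ 2 / (A + p ^ 2) := by field_simp; ring
      linarith
    -- gradient bound
    set D := -(p * q) + L * η * p ^ 2 with hD
    have hG : 0 ≤ G := le_trans (abs_nonneg _) hat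
    have hD2 : D ^ 2 ≤ 9 * G ^ 2 * p ^ 2 := by
      have h1 : D = p * (L * η * p - q) := by rw [hD]; ring
      have hLη : L * η ≤ 2 := by
        have := mul_le_mul_of_nonneg_left hη2 hL.le
        rwa [mul_div_cancel₀ _ hL.ne'] at this
      have h2 : |L * η * p - q| ≤ 3 * G := by
        calc |L * η * p - q| ≤ |L * η * p| + |q| := abs_sub _ _
          _ = L * η * |p| + |q| := by rw [abs_mul, abs_of_nonneg (by positivity)]
          _ ≤ 2 * G + G := by gcongr
          _ = 3 * G := by ring
      have h3 : (L * η * p - q) ^ 2 ≤ (3 * G) ^ 2 := sq_le_sq' (by linarith [abs_le.1 h2]) (by linarith [abs_le.1 h2])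
      rw [h1, mul_pow]
      nlinarith [sq_nonneg p]
    have hquad : -(D ^ 2 / (2 * L * (A + p ^ 2))) ≤ D * (u - η) + L * (A + p^2) / 2 * (u - η) ^ 2 := by
      have : D * (u - η) + L * (A + p^2) / 2 * (u - η) ^ 2 + D ^ 2 / (2 * L * (A + p ^ 2))
        = (L * (A + p^2) * (u - η) + D) ^ 2 / (2 * L * (A + p ^ 2)) := by field_simp; ring
      have : 0 ≤ (L * (A + p^2) * (u - η) + D) ^ 2 / (2 * L * (A + p ^ 2)) := by positivity
      linarith
    have hR : D ^ 2 / (2 * L * (A + p ^ 2)) ≤ 9 * G ^ 2 / (2 * L) *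
        (Real.log ((A + p ^ 2) / α) - Real.log (A / α)) := by
      calc D ^ 2 / (2 * L * (A + p ^ 2)) ≤ 9 * G ^ 2 * p ^ 2 / (2 * L * (A + p ^ 2)) := by gcongr
        _ = 9 * G ^ 2 / (2 * L) * (p ^ 2 / (A + p ^ 2)) := by field_simp
        _ ≤ _ := by gcongr
    have hΦ : ∀ v : ℝ, L * α / 2 * (v - 1 / L) ^ 2 = L * α / 2 * v ^ 2 - α * v + α / (2 * L) := by
      intro v; field_simp; ring
    rw [hΦ] at iht ⊢
    have hSA : S = A - α := by rw [hA]; ring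
    rw [hSA] at iht ⊢
    rw [mul_sub] at hR
    rw [hD] at hquad
    rw [hD] at hR
    linear_combination iht + hR + hquad + hclip

lemma sg_quad (L C X Y : ℝ) (hL : 0 < L) (hX : 0 ≤ X) (hXY : X ≤ Y)
    (h : ∀ u, 0 ≤ u → u ≤ 2 / L → u * X - L / 2 * u ^ 2 * Y ≤ C) : 
    X ≤ 2 * L * C + Real.sqrt (2 * L * C * (Y - X)) := by
  have hC : 0 ≤ C := by have := h 0 le_rfl (by positivity); simpa using this
  have h1 : X ^ 2 ≤ 2 * L * C * Y := by
    rcases (hX.trans hXY).eq_or_lt with h0 | h0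
    · have : X = 0 := by linarith
      rw [this, ← h0]; simp
    · have h2 := h (X / (L * Y)) (by positivity) (by
        rw [div_le_div_iff₀ (by positivity) hL]; nlinarith)
      have : X / (L * Y) * X - L / 2 * (X / (L * Y)) ^ 2 * Y = X ^ 2 / (2 * L * Y) := by
        field_simp; ring
      rw [this, div_le_iff₀ (by positivity)] at h2
      linarith
  set b := 2 * L * C with hb
  have hb0 : 0 ≤ b := by positivity
  set s := Real.sqrt (b * (Y - X)) with hs
  have hs0 : 0 ≤ s := Real.sqrt_nonneg _
  have hs2 : s ^ 2 = b * (Y - X) := Real.sq_sqrt (mul_nonneg hb0 (by linarith))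
  by_contra hcon
  push Not at hcon
  nlinarith [mul_nonneg hb0 hs0]

lemma sg_descent {d : ℕ} (F : EuclideanSpace ℝ (Fin d) → ℝ) (L : ℝ)
    (hdiff : Differentiable ℝ F) 
    (hsmooth : ∀ y z, ‖gradient F y - gradient F z‖ ≤ L * ‖y - z‖)
    (x y : EuclideanSpace ℝ (Fin d)) :
    F y ≤ F x + inner ℝ (gradient F x) (y - x) + L / 2 * ‖y - x‖ ^ 2 := by
  set v := y - x with hv
  let φ : ℝ → ℝ := fun s => F (x + s • v) - s * inner ℝ (gradient F x) v - L / 2 * s ^ 2 * ‖v‖ ^ 2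
  have hd : ∀ s : ℝ, HasDerivAt φ (inner ℝ (gradient F (x + s • v)) v
      - inner ℝ (gradient F x) v - L * s * ‖v‖ ^ 2) s := by
    intro s
    have h1 : HasDerivAt (fun s : ℝ => x + s • v) v s := by
      simpa using ((hasDerivAt_id s).smul_const v).const_add x
    have h2 := (hdiff (x + s • v)).hasGradientAt.hasFDerivAt.comp_hasDerivAt s h1
    have h3 := (h2.sub ((hasDerivAt_id s).mul_const (inner ℝ (gradient F x) v))).sub
      ((((hasDerivAt_id s).pow 2).const_mul (L/2)).mul_const (‖v‖^2))
    have h3' : HasDerivAt φ _ s := h3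
    convert h3' using 1
    simp
    left
    ring
  have hanti : AntitoneOn φ (Set.Icc 0 1) := by
    apply antitoneOn_of_deriv_nonpos (convex_Icc 0 1)
    · exact fun s _ => (hd s).continuousAt.continuousWithinAt
    · exact fun s _ => (hd s).differentiableAt.differentiableWithinAt
    · intro s hs
      rw [interior_Icc] at hs
      rw [(hd s).deriv, ← inner_sub_left]
      have h1 := real_inner_le_norm (gradient F (x + s • v) - gradient F x) v
      have h2 := hsmooth (x + s • v) x
      rw [add_sub_cancel_left, norm_smul, Real.norm_of_nonneg hs.1.le] at h2
      have := mul_le_mul_of_nonneg_right h2 (norm_nonneg v)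
      nlinarith
  have := hanti (Set.left_mem_Icc.2 zero_le_one) (Set.right_mem_Icc.2 zero_le_one) zero_le_one
  simp [φ] at this
  have hy : x + v = y := by rw [hv]; abel
  rw [hy] at this
  rw [inner_gradient_left]
  linarith

lemma sg_pull {Ω : Type*} {m m0 : MeasurableSpace Ω} (hm : m ≤ m0)
    (μ : Measure Ω) [IsProbabilityMeasure μ] (h f q : Ω → ℝ) (hh : StronglyMeasurable[m] h)
    (hf : Integrable f μ) (hhf : Integrable (fun ω => h ω * f ω) μ) (hq : μ[f | m] =ᵐ[μ] q) :
    ∫ ω, h ω * f ω ∂μ = ∫ ω, h ω * q ω ∂μ := by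
  rw [← integral_condExp hm]
  apply integral_congr_ae
  have := condExp_mul_of_stronglyMeasurable_left hh (g := f) (μ := μ) hhf hf
  filter_upwards [this, hq] with ω h1 h2
  have h1' : (μ[fun ω => h ω * f ω | m]) ω = (h * μ[f | m]) ω := h1
  rw [h1', Pi.mul_apply, h2]

lemma sg_coord {Ω : Type*} {m m0 : MeasurableSpace Ω} (hm : m ≤ m0)
    (μ : Measure Ω) [IsProbabilityMeasure μ] (a b p η : Ω → ℝ) (G c s : ℝ)
    (ha : StronglyMeasurable[m0] a) (hb : StronglyMeasurable[m0] b)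
    (hp : StronglyMeasurable[m] p) (hη : StronglyMeasurable[m] η)
    (haG : ∀ᵐ ω ∂μ, |a ω| ≤ G) (hbG : ∀ᵐ ω ∂μ, |b ω| ≤ G)
    (hηc : ∀ ω, |η ω| ≤ c) (hp2 : Integrable (fun ω => p ω ^ 2) μ)
    (hap : μ[a | m] =ᵐ[μ] p) (habp : μ[(fun ω => a ω * b ω) | m] =ᵐ[μ] fun ω => p ω ^ 2)
    (hvar : μ[(fun ω => (a ω - p ω) ^ 2) | m] ≤ᵐ[μ] fun _ => s) :
    Integrable (fun ω => η ω * (a ω * b ω)) μ ∧ Integrable (fun ω => η ω * p ω * a ω) μ ∧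
    ∫ ω, η ω * (a ω * b ω) ∂μ = ∫ ω, η ω * p ω * a ω ∂μ ∧
    Integrable (fun ω => a ω * b ω) μ ∧ ∫ ω, a ω * b ω ∂μ = ∫ ω, p ω ^ 2 ∂μ ∧
    Integrable (fun ω => a ω ^ 2) μ ∧ ∫ ω, a ω ^ 2 ∂μ ≤ ∫ ω, p ω ^ 2 ∂μ + s := by
  have hp0 := hp.mono hm
  have hη0 := hη.mono hm
  have iA : Integrable a μ := Integrable.of_bound ha.aestronglyMeasurable G haG
  have iB : Integrable b μ := Integrable.of_bound hb.aestronglyMeasurable G hbG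
  have iAB : Integrable (fun ω => a ω * b ω) μ := iB.bdd_mul ha.aestronglyMeasurable haG
  have iAA : Integrable (fun ω => a ω ^ 2) μ := by
    simpa only [pow_two] using iA.bdd_mul ha.aestronglyMeasurable haG
  have iηAB : Integrable (fun ω => η ω * (a ω * b ω)) μ :=
    iAB.bdd_mul hη0.aestronglyMeasurable (ae_of_all _ hηc)
  have iP : Integrable p μ :=
    ((memLp_two_iff_integrable_sq hp0.aestronglyMeasurable).2 hp2).integrable (by norm_num)
  have iPA : Integrable (fun ω => p ω * a ω) μ := iP.mul_bdd ha.aestronglyMeasurable haG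
  have iηPA : Integrable (fun ω => η ω * p ω * a ω) μ := by
    simpa only [mul_assoc] using iPA.bdd_mul hη0.aestronglyMeasurable (ae_of_all _ hηc)
  have e1 := sg_pull hm μ η _ _ hη iAB iηAB habp
  have e2 := sg_pull hm μ (fun ω => η ω * p ω) _ _ (hη.mul hp) iA iηPA hap
  have e3 := sg_pull hm μ p _ _ hp iA iPA hap
  have e4 : ∫ ω, a ω * b ω ∂μ = ∫ ω, p ω ^ 2 ∂μ := by
    rw [← integral_condExp hm]; exact integral_congr_ae habp
  have e5 : ∫ ω, (a ω - p ω) ^ 2 ∂μ ≤ s := by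
    rw [← integral_condExp hm]
    have := integral_mono_ae integrable_condExp (integrable_const s) hvar
    simpa using this
  have e6 : ∫ ω, (a ω - p ω) ^ 2 ∂μ
      = ∫ ω, a ω ^ 2 ∂μ - 2 * ∫ ω, p ω * a ω ∂μ + ∫ ω, p ω ^ 2 ∂μ := by
    have iD : Integrable (fun ω => a ω ^ 2 - 2 * (p ω * a ω)) μ := iAA.sub (iPA.const_mul 2)
    rw [← integral_const_mul, ← integral_sub iAA (iPA.const_mul 2),
      ← integral_add iD hp2]
    congr 1; ext ω; ring
  refine ⟨iηAB, iηPA, ?_, iAB, e4, iAA, ?_⟩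
  · rw [e1, e2]; congr 1; ext ω; ring
  · have e3' : ∫ ω, p ω * a ω ∂μ = ∫ ω, p ω ^ 2 ∂μ := by
      rw [e3]; congr 1; ext ω; ring
    rw [e6, e3'] at e5
    linarith

def sgHasInt {Ω : Type*} [MeasurableSpace Ω] (μ : Measure Ω) (f : Ω → ℝ) (c : ℝ) : Prop :=
  Integrable f μ ∧ ∫ ω, f ω ∂μ = c

/-- Convergence of per-coordinate SGDOL: per-coordinate and total bounds. -/
theorem sgdol_per_coordinate_convergence {d : ℕ}
    {Ω : Type*} [m0 : MeasurableSpace Ω]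
    (μ : Measure Ω) [IsProbabilityMeasure μ] (ℱ : Filtration ℕ m0)
    (F : EuclideanSpace ℝ (Fin d) → ℝ) (L Fstar α : ℝ) (σ G : Fin d → ℝ)
    (hdiff : Differentiable ℝ F) (hL : 0 < L) (hα : 0 < α)
    (hGnonneg : ∀ j, 0 ≤ G j) (hσnonneg : ∀ j, 0 ≤ σ j)
    (hsmooth : ∀ y z, ‖gradient F y - gradient F z‖ ≤ L * ‖y - z‖)
    (hbdd : ∀ y, Fstar ≤ F y)
    (T : ℕ) (hT : 1 ≤ T)
    (x g g' : ℕ → Ω → EuclideanSpace ℝ (Fin d))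
    (x1 : EuclideanSpace ℝ (Fin d)) (hx1 : ∀ ω, x 1 ω = x1)
    (hxmeas : ∀ t ∈ Finset.Icc 1 T, StronglyMeasurable[ℱ (t - 1)] (x t))
    (hgmeas : ∀ t ∈ Finset.Icc 1 T, StronglyMeasurable[ℱ t] (g t))
    (hg'meas : ∀ t ∈ Finset.Icc 1 T, StronglyMeasurable[ℱ t] (g' t))
    (hunb : ∀ t ∈ Finset.Icc 1 T,
      μ[g t | ℱ (t - 1)] =ᵐ[μ] fun ω => gradient F (x t ω))
    (hunb' : ∀ t ∈ Finset.Icc 1 T,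
      μ[g' t | ℱ (t - 1)] =ᵐ[μ] fun ω => gradient F (x t ω))
    (hindep : ∀ t ∈ Finset.Icc 1 T, ∀ j,
      μ[(fun ω => g t ω j * g' t ω j) | ℱ (t - 1)]
        =ᵐ[μ] fun ω => (gradient F (x t ω) j) ^ 2)
    (hvar : ∀ t ∈ Finset.Icc 1 T, ∀ j,
      μ[(fun ω => (g t ω j - gradient F (x t ω) j) ^ 2) | ℱ (t - 1)]
        ≤ᵐ[μ] fun _ => (σ j) ^ 2)
    (hgbound : ∀ t ∈ Finset.Icc 1 T, ∀ j, ∀ᵐ ω ∂μ, |g t ω j| ≤ G j)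
    (hg'bound : ∀ t ∈ Finset.Icc 1 T, ∀ j, ∀ᵐ ω ∂μ, |g' t ω j| ≤ G j)
    (hupdate : ∀ t ∈ Finset.Icc 1 T, ∀ ω, ∀ j,
      x (t + 1) ω j = x t ω j -
        (max 0 (min ((α + ∑ i ∈ Finset.Icc 1 (t - 1), g i ω j * g' i ω j) /
            (L * (α + ∑ i ∈ Finset.Icc 1 (t - 1), (g i ω j) ^ 2))) (2 / L))) * g t ω j)
    (hintF : ∀ t ∈ Finset.Icc 1 (T + 1), Integrable (fun ω => F (x t ω)) μ)
    (hintgrad : ∀ t ∈ Finset.Icc 1 T,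
      Integrable (fun ω => ‖gradient F (x t ω)‖ ^ 2) μ)
    (hintgradco : ∀ t ∈ Finset.Icc 1 T, ∀ j,
      Integrable (fun ω => (gradient F (x t ω) j) ^ 2) μ) :
    (∀ j, (∫ ω, ∑ t ∈ Finset.Icc 1 T, (gradient F (x t ω) j) ^ 2 ∂μ) ≤
        2 * L * (F x1 - Fstar
            + ∑ i, 5 * (G i) ^ 2 / L * Real.log (1 + (G i) ^ 2 * T / α))
        + Real.sqrt (2 * L * (σ j) ^ 2 * T * (F x1 - Fstar + d * α / (2 * L)))
        + Real.sqrt (10 * (σ j) ^ 2 * T *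
            ∑ i, (G i) ^ 2 * Real.log (1 + (G i) ^ 2 * T / α))
        + ((d : ℝ) - 1) * α)
    ∧ ((∫ ω, ∑ t ∈ Finset.Icc 1 T, ‖gradient F (x t ω)‖ ^ 2 ∂μ) ≤
        2 * L * (F x1 - Fstar
            + 5 / L * ∑ i, (G i) ^ 2 * Real.log (1 + (G i) ^ 2 * T / α))
        + Real.sqrt (2 * L * (∑ j, (σ j) ^ 2) * T * (F x1 - Fstar + d * α / (2 * L)))
        + Real.sqrt (10 * (∑ j, (σ j) ^ 2) * T *
            ∑ i, (G i) ^ 2 * Real.log (1 + (G i) ^ 2 * T / α))) := by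
  have hTpos : (0 : ℝ) < T := by exact_mod_cast hT
  -- notation
  let a : ℕ → Fin d → Ω → ℝ := fun t j ω => g t ω j
  let b : ℕ → Fin d → Ω → ℝ := fun t j ω => g' t ω j
  let p : ℕ → Fin d → Ω → ℝ := fun t j ω => gradient F (x t ω) j
  let η : ℕ → Fin d → Ω → ℝ := fun t j ω => sgEta L α (fun i => g i ω j) (fun i => g' i ω j) t
  have hgradcont : Continuous (gradient F) := by
    have : LipschitzWith L.toNNReal (gradient F) := by
      apply LipschitzWith.of_dist_le_mul
      intro y z
      rw [dist_eq_norm, dist_eq_norm, Real.coe_toNNReal _ hL.le]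
      exact hsmooth y z
    exact this.continuous
  have hproj : ∀ j : Fin d, Continuous fun v : EuclideanSpace ℝ (Fin d) => v j := by
    intro j; exact (EuclideanSpace.proj (𝕜 := ℝ) j).continuous
  have hηmeas : ∀ t ∈ Finset.Icc 1 T, ∀ j, StronglyMeasurable[ℱ (t - 1)] (η t j) := by
    intro t ht j
    have ht' := Finset.mem_Icc.1 ht
    have hma : ∀ i ∈ Finset.Icc 1 (t - 1), Measurable[ℱ (t - 1)] (a i j) := by
      intro i hi
      have hi' := Finset.mem_Icc.1 hi
      exact ((hproj j).comp_stronglyMeasurable ((hgmeas i (Finset.mem_Icc.2 ⟨hi'.1, by omega⟩)).mono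
        (ℱ.mono hi'.2))).measurable
    have hmb : ∀ i ∈ Finset.Icc 1 (t - 1), Measurable[ℱ (t - 1)] (b i j) := by
      intro i hi
      have hi' := Finset.mem_Icc.1 hi
      exact ((hproj j).comp_stronglyMeasurable ((hg'meas i (Finset.mem_Icc.2 ⟨hi'.1, by omega⟩)).mono
        (ℱ.mono hi'.2))).measurable
    have h1 : Measurable[ℱ (t - 1)] fun ω => ∑ i ∈ Finset.Icc 1 (t - 1), a i j ω * b i j ω :=
      Finset.measurable_fun_sum _ fun i hi => (hma i hi).mul (hmb i hi)
    have h2 : Measurable[ℱ (t - 1)] fun ω => ∑ i ∈ Finset.Icc 1 (t - 1), a i j ω ^ 2 :=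
      Finset.measurable_fun_sum _ fun i hi => (hma i hi).pow_const 2
    have h3 : Measurable[ℱ (t - 1)] (η t j) :=
      measurable_const.max (((h1.const_add α).div ((h2.const_add α).const_mul L)).min
        measurable_const)
    exact h3.stronglyMeasurable
  have key : ∀ t ∈ Finset.Icc 1 T, ∀ j, _ := fun t ht j =>
    sg_coord (ℱ.le (t - 1)) μ (a t j) (b t j) (p t j) (η t j) (G j) (2 / L) (σ j ^ 2)
      ((hproj j).comp_stronglyMeasurable ((hgmeas t ht).mono (ℱ.le t)))
      ((hproj j).comp_stronglyMeasurable ((hg'meas t ht).mono (ℱ.le t)))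
      (((hproj j).comp hgradcont).comp_stronglyMeasurable (hxmeas t ht))
      (hηmeas t ht j) (hgbound t ht j) (hg'bound t ht j)
      (fun ω => by
        rw [abs_of_nonneg (sgEta_nonneg _ _ _ _ _)]
        exact sgEta_le _ _ hL _ _ _)
      (hintgradco t ht j)
      (by
        have ig : Integrable (g t) μ := by
          refine Integrable.of_bound ((hgmeas t ht).mono (ℱ.le t)).aestronglyMeasurable
            (∑ i, G i) ?_
          have hall : ∀ᵐ ω ∂μ, ∀ i, |g t ω i| ≤ G i := ae_all_iff.2 (hgbound t ht)
          filter_upwards [hall] with ω hω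
          have h1 : ‖g t ω‖ ≤ ∑ i, |g t ω i| := by
            rw [EuclideanSpace.norm_eq]
            apply Real.sqrt_le_iff.2
            refine ⟨Finset.sum_nonneg fun i _ => abs_nonneg _, ?_⟩
            exact Finset.sum_sq_le_sq_sum_of_nonneg fun i _ => abs_nonneg _
          exact h1.trans (Finset.sum_le_sum fun i _ => hω i)
        have h1 := (EuclideanSpace.proj (𝕜 := ℝ) j).comp_condExp_comm (m := ℱ (t - 1)) ig
        have h2 : (fun ω => (μ[g t | ℱ (t - 1)]) ω j) =ᵐ[μ] μ[a t j | ℱ (t - 1)] := h1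
        filter_upwards [h2, hunb t ht] with ω h3 h4
        rw [← h3, h4])
      (hindep t ht j) (hvar t ht j)
  -- main inequality
  have hmain : ∀ u : Fin d → ℝ, (∀ j, 0 ≤ u j) → (∀ j, u j ≤ 2 / L) →
      Fstar - F x1 ≤ ∑ j, (-(u j * ∑ t ∈ Finset.Icc 1 T, ∫ ω, p t j ω ^ 2 ∂μ)
        + L / 2 * (u j ^ 2 * ∑ t ∈ Finset.Icc 1 T, ∫ ω, a t j ω ^ 2 ∂μ)
        + (L * α / 2 * (u j - 1 / L) ^ 2
          + 5 * G j ^ 2 / L * Real.log (1 + G j ^ 2 * T / α))) := by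
    intro u hu0 hu2
    have hdesc : ∀ ω, ∀ t ≤ T, F (x (t + 1) ω) ≤ F x1 + ∑ i ∈ Finset.Icc 1 t, ∑ j,
        (-(η i j ω * p i j ω * a i j ω) + L / 2 * (η i j ω ^ 2 * a i j ω ^ 2)) := by
      intro ω t
      induction t with
      | zero => intro _; simp [hx1]
      | succ t ih =>
        intro ht
        rw [Finset.sum_Icc_succ_top (show 1 ≤ t + 1 by omega)]
        have h1 := ih (by omega)
        have h2 := sg_descent F L hdiff hsmooth (x (t+1) ω) (x (t+1+1) ω)
        have h3 : ∀ j, (x (t+1+1) ω - x (t+1) ω) j = -(η (t+1) j ω * a (t+1) j ω) := by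
          intro j
          have := hupdate (t+1) (Finset.mem_Icc.2 ⟨by omega, ht⟩) ω j
          rw [PiLp.sub_apply, this]
          simp only [η, a, sgEta]
          ring
        have h4 : inner ℝ (gradient F (x (t+1) ω)) (x (t+1+1) ω - x (t+1) ω)
            = ∑ j, -(η (t+1) j ω * p (t+1) j ω * a (t+1) j ω) := by
          rw [PiLp.inner_apply]
          refine Finset.sum_congr rfl fun j _ => ?_
          rw [h3 j]
          simp only [p, RCLike.inner_apply, conj_trivial]
          ring
        have h5 : ‖x (t+1+1) ω - x (t+1) ω‖ ^ 2 = ∑ j, η (t+1) j ω ^ 2 * a (t+1) j ω ^ 2 := by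
          rw [EuclideanSpace.real_norm_sq_eq]
          refine Finset.sum_congr rfl fun j _ => ?_
          rw [h3 j]; ring
        rw [h4, h5] at h2
        rw [Finset.sum_add_distrib, ← Finset.mul_sum]
        linarith
    let H : Fin d → Ω → ℝ := fun j ω =>
      ∑ t ∈ Finset.Icc 1 T, (η t j ω * (a t j ω * b t j ω) - η t j ω * p t j ω * a t j ω
        + (-(u j * (a t j ω * b t j ω)) + L / 2 * (u j ^ 2 * a t j ω ^ 2)))
        + (L * α / 2 * (u j - 1 / L) ^ 2 + 5 * G j ^ 2 / L * Real.log (1 + G j ^ 2 * T / α))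
    have hle : ∀ᵐ ω ∂μ, Fstar - F x1 ≤ ∑ j, H j ω := by
      have hA : ∀ᵐ ω ∂μ, ∀ t, ∀ j, t ∈ Finset.Icc 1 T → |g t ω j| ≤ G j :=
        ae_all_iff.2 fun t => ae_all_iff.2 fun j => by
          by_cases ht : t ∈ Finset.Icc 1 T
          · filter_upwards [hgbound t ht j] with ω h _ using h
          · exact ae_of_all _ fun ω h => absurd h ht
      have hB : ∀ᵐ ω ∂μ, ∀ t, ∀ j, t ∈ Finset.Icc 1 T → |g' t ω j| ≤ G j :=
        ae_all_iff.2 fun t => ae_all_iff.2 fun j => by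
          by_cases ht : t ∈ Finset.Icc 1 T
          · filter_upwards [hg'bound t ht j] with ω h _ using h
          · exact ae_of_all _ fun ω h => absurd h ht
      filter_upwards [hA, hB] with ω hAω hBω
      have h1 := hdesc ω T le_rfl
      have h2 := hbdd (x (T+1) ω)
      rw [Finset.sum_comm] at h1
      have h3 : ∀ j, ∑ t ∈ Finset.Icc 1 T,
          (-(η t j ω * p t j ω * a t j ω) + L / 2 * (η t j ω ^ 2 * a t j ω ^ 2)) ≤ H j ω := by
        intro j
        have hr := sg_regret L α (G j) hL hα (fun i => g i ω j) (fun i => g' i ω j) T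
          (fun t ht => hAω t j ht) (fun t ht => hBω t j ht) T le_rfl (u j) (hu0 j) (hu2 j)
        have hlog : Real.log ((α + ∑ i ∈ Finset.Icc 1 T, (g i ω j) ^ 2) / α)
            ≤ Real.log (1 + G j ^ 2 * T / α) := by
          have hS0 : 0 ≤ ∑ i ∈ Finset.Icc 1 T, (g i ω j) ^ 2 :=
            Finset.sum_nonneg fun i _ => sq_nonneg _
          have hS : ∑ i ∈ Finset.Icc 1 T, (g i ω j) ^ 2 ≤ G j ^ 2 * T := by
            calc ∑ i ∈ Finset.Icc 1 T, (g i ω j) ^ 2 ≤ ∑ i ∈ Finset.Icc 1 T, G j ^ 2 :=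
                  Finset.sum_le_sum fun i hi => by
                    have := hAω i j hi
                    exact sq_le_sq' (by linarith [abs_le.1 this]) (by linarith [abs_le.1 this])
              _ = G j ^ 2 * T := by simp [mul_comm]
          apply Real.log_le_log (by positivity)
          rw [add_div, div_self hα.ne']
          gcongr
        have hlog0 : 0 ≤ Real.log (1 + G j ^ 2 * T / α) :=
          Real.log_nonneg (by have : 0 ≤ G j ^ 2 * T / α := by positivity
                              linarith)
        have hc : 9 * G j ^ 2 / (2 * L) * Real.log ((α + ∑ i ∈ Finset.Icc 1 T, (g i ω j) ^ 2) / α)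
            ≤ 5 * G j ^ 2 / L * Real.log (1 + G j ^ 2 * T / α) := by
          calc _ ≤ 9 * G j ^ 2 / (2 * L) * Real.log (1 + G j ^ 2 * T / α) := by gcongr
            _ ≤ _ := by
              apply mul_le_mul_of_nonneg_right _ hlog0
              rw [div_le_div_iff₀ (by positivity) hL]
              have : 0 ≤ G j ^ 2 * L := by positivity
              linarith
        have e : H j ω = ∑ t ∈ Finset.Icc 1 T,
            (η t j ω * (a t j ω * b t j ω) - η t j ω * p t j ω * a t j ω)
            + ∑ t ∈ Finset.Icc 1 T, (-(u j * (a t j ω * b t j ω)) + L / 2 * (u j ^ 2 * a t j ω ^ 2))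
            + (L * α / 2 * (u j - 1 / L) ^ 2
              + 5 * G j ^ 2 / L * Real.log (1 + G j ^ 2 * T / α)) := by
          rw [← Finset.sum_add_distrib]
        have e2 : ∑ t ∈ Finset.Icc 1 T,
            (-(η t j ω * p t j ω * a t j ω) + L / 2 * (η t j ω ^ 2 * a t j ω ^ 2))
            = ∑ t ∈ Finset.Icc 1 T,
              (η t j ω * (a t j ω * b t j ω) - η t j ω * p t j ω * a t j ω)
            + ∑ t ∈ Finset.Icc 1 T, (-(η t j ω * (a t j ω * b t j ω))
              + L / 2 * (η t j ω ^ 2 * a t j ω ^ 2)) := by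
          rw [← Finset.sum_add_distrib]
          exact Finset.sum_congr rfl fun t _ => by ring
        have hr' : ∑ t ∈ Finset.Icc 1 T, (-(η t j ω * (a t j ω * b t j ω))
              + L / 2 * (η t j ω ^ 2 * a t j ω ^ 2)) ≤
            ∑ t ∈ Finset.Icc 1 T, (-(u j * (a t j ω * b t j ω)) + L / 2 * (u j ^ 2 * a t j ω ^ 2))
            + L * α / 2 * (u j - 1 / L) ^ 2 + 9 * G j ^ 2 / (2 * L) *
              Real.log ((α + ∑ i ∈ Finset.Icc 1 T, (g i ω j) ^ 2) / α) := hr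
        rw [e, e2]
        linarith
      have h4 := Finset.sum_le_sum fun j (_ : j ∈ Finset.univ) => h3 j
      linarith
    have hterm : ∀ j, ∀ t ∈ Finset.Icc 1 T, sgHasInt μ
        (fun ω => η t j ω * (a t j ω * b t j ω) - η t j ω * p t j ω * a t j ω
        + (-(u j * (a t j ω * b t j ω)) + L / 2 * (u j ^ 2 * a t j ω ^ 2)))
        (-(u j * ∫ ω, p t j ω ^ 2 ∂μ) + L / 2 * (u j ^ 2 * ∫ ω, a t j ω ^ 2 ∂μ)) := by
      intro j t ht
      obtain ⟨i1, i2, e1, i3, e2, i4, -⟩ := key t ht j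
      have j1 : Integrable (fun ω => η t j ω * (a t j ω * b t j ω) - η t j ω * p t j ω * a t j ω) μ :=
        i1.sub i2
      have j2 : Integrable (fun ω => -(u j * (a t j ω * b t j ω))) μ := (i3.const_mul _).neg
      have j3 : Integrable (fun ω => L / 2 * (u j ^ 2 * a t j ω ^ 2)) μ :=
        (i4.const_mul _).const_mul _
      have j4 : Integrable (fun ω => -(u j * (a t j ω * b t j ω))
        + L / 2 * (u j ^ 2 * a t j ω ^ 2)) μ := j2.add j3
      refine ⟨j1.add j4, ?_⟩
      rw [integral_add j1 j4, integral_add j2 j3, integral_sub i1 i2, integral_neg,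
        integral_const_mul, integral_const_mul, integral_const_mul, e1, e2]
      ring
    have hH : ∀ j, sgHasInt μ (H j) (-(u j * ∑ t ∈ Finset.Icc 1 T, ∫ ω, p t j ω ^ 2 ∂μ)
        + L / 2 * (u j ^ 2 * ∑ t ∈ Finset.Icc 1 T, ∫ ω, a t j ω ^ 2 ∂μ)
        + (L * α / 2 * (u j - 1 / L) ^ 2
          + 5 * G j ^ 2 / L * Real.log (1 + G j ^ 2 * T / α))) := by
      intro j
      have j1 := integrable_finsetSum (Finset.Icc 1 T) fun t ht => (hterm j t ht).1
      refine ⟨j1.add (integrable_const _), ?_⟩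
      simp only [H]
      rw [integral_add j1 (integrable_const _),
        integral_finsetSum _ fun t ht => (hterm j t ht).1,
        Finset.sum_congr rfl fun t ht => (hterm j t ht).2, Finset.sum_add_distrib,
        Finset.sum_neg_distrib, Finset.mul_sum, Finset.mul_sum, Finset.mul_sum]
      simp
    have hfin := integral_mono_ae (integrable_const (Fstar - F x1))
      (integrable_finsetSum Finset.univ fun j _ => (hH j).1) hle
    rw [integral_finsetSum _ fun j _ => (hH j).1, Finset.sum_congr rfl fun j _ => (hH j).2] at hfin
    simpa using hfin
  -- notation for sums
  obtain ⟨S, hS⟩ : ∃ S : Fin d → ℝ, ∀ j, S j = ∑ t ∈ Finset.Icc 1 T, ∫ ω, p t j ω ^ 2 ∂μ :=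
    ⟨_, fun _ => rfl⟩
  obtain ⟨V, hV⟩ : ∃ V : Fin d → ℝ, ∀ j, V j = ∑ t ∈ Finset.Icc 1 T, ∫ ω, a t j ω ^ 2 ∂μ :=
    ⟨_, fun _ => rfl⟩
  have hS0 : ∀ j, 0 ≤ S j := fun j => by
    rw [hS]; exact Finset.sum_nonneg fun t _ => integral_nonneg fun ω => sq_nonneg _
  have hVS : ∀ j, V j ≤ S j + σ j ^ 2 * T := by
    intro j
    rw [hS, hV]
    calc _ ≤ ∑ t ∈ Finset.Icc 1 T, (∫ ω, p t j ω ^ 2 ∂μ + σ j ^ 2) :=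
          Finset.sum_le_sum fun t ht => (key t ht j).2.2.2.2.2.2
      _ = _ := by rw [Finset.sum_add_distrib]; simp [mul_comm]
  have hSint : ∀ j, ∫ ω, ∑ t ∈ Finset.Icc 1 T, (gradient F (x t ω) j) ^ 2 ∂μ = S j := by
    intro j
    rw [hS, integral_finsetSum _ fun t ht => hintgradco t ht j]
  have hSall : ∫ ω, ∑ t ∈ Finset.Icc 1 T, ‖gradient F (x t ω)‖ ^ 2 ∂μ = ∑ j, S j := by
    have : ∀ ω, ∑ t ∈ Finset.Icc 1 T, ‖gradient F (x t ω)‖ ^ 2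
        = ∑ j, ∑ t ∈ Finset.Icc 1 T, (gradient F (x t ω) j) ^ 2 := by
      intro ω
      rw [Finset.sum_comm]
      exact Finset.sum_congr rfl fun t _ => EuclideanSpace.real_norm_sq_eq _
    simp only [this]
    rw [integral_finsetSum _ fun j _ => integrable_finsetSum _ fun t ht => hintgradco t ht j]
    exact Finset.sum_congr rfl fun j _ => hSint j
  simp only [← hS, ← hV] at hmain
  rw [hSall]
  simp only [hSint]
  set K := ∑ i, (G i) ^ 2 * Real.log (1 + (G i) ^ 2 * T / α) with hK
  have hK0 : 0 ≤ K := Finset.sum_nonneg fun i _ => mul_nonneg (sq_nonneg _)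
    (Real.log_nonneg (by have : 0 ≤ G i ^ 2 * T / α := by positivity
                         linarith))
  have hK5 : ∑ i, 5 * (G i) ^ 2 / L * Real.log (1 + (G i) ^ 2 * T / α) = 5 / L * K := by
    rw [hK, Finset.mul_sum]
    exact Finset.sum_congr rfl fun i _ => by ring
  have hΔ : 0 ≤ F x1 - Fstar := by linarith [hbdd x1]
  have hmain2 : ∀ u : Fin d → ℝ, (∀ j, 0 ≤ u j) → (∀ j, u j ≤ 2 / L) →
      ∑ j, (u j * (S j + α) - L / 2 * u j ^ 2 * (S j + α + σ j ^ 2 * T))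
        ≤ F x1 - Fstar + 5 / L * K + d * α / (2 * L) := by
    intro u hu0 hu2
    have h1 := hmain u hu0 hu2
    rw [← hK5]
    have h2 : ∑ j, (-(u j * S j) + L / 2 * (u j ^ 2 * V j)
        + (L * α / 2 * (u j - 1 / L) ^ 2
          + 5 * G j ^ 2 / L * Real.log (1 + G j ^ 2 * T / α)))
        ≤ ∑ j, (-(u j * (S j + α) - L / 2 * u j ^ 2 * (S j + α + σ j ^ 2 * T)) + (α / (2 * L)
          + 5 * G j ^ 2 / L * Real.log (1 + G j ^ 2 * T / α))) := by
      refine Finset.sum_le_sum fun j _ => ?_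
      have h3 : L * α / 2 * (u j - 1 / L) ^ 2 = L * α / 2 * u j ^ 2 - α * u j + α / (2 * L) := by
        field_simp; ring
      have h4 := mul_le_mul_of_nonneg_left (hVS j) (show 0 ≤ L / 2 * u j ^ 2 by positivity)
      rw [h3]
      linarith
    replace h2 := h1.trans h2
    rw [Finset.sum_add_distrib, Finset.sum_add_distrib, Finset.sum_neg_distrib] at h2
    have h5 : ∑ _j : Fin d, α / (2 * L) = d * α / (2 * L) := by simp [mul_div_assoc]
    rw [h5] at h2
    linarith
  have hfinal : ∀ X s2 : ℝ, 0 ≤ s2 →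
      X ≤ 2 * L * (F x1 - Fstar + 5 / L * K + d * α / (2 * L)) + Real.sqrt
        (2 * L * (F x1 - Fstar + 5 / L * K + d * α / (2 * L)) * (s2 * T)) →
      X ≤ 2 * L * (F x1 - Fstar + 5 / L * K) + d * α
        + Real.sqrt (2 * L * s2 * T * (F x1 - Fstar + d * α / (2 * L)))
        + Real.sqrt (10 * s2 * T * K) := by
    intro X s2 hs2 h
    have e1 : 2 * L * (F x1 - Fstar + 5 / L * K + d * α / (2 * L)) * (s2 * T)
        = 2 * L * s2 * T * (F x1 - Fstar + d * α / (2 * L)) + 10 * s2 * T * K := by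
      field_simp; ring
    have e2 : 2 * L * (F x1 - Fstar + 5 / L * K + d * α / (2 * L))
        = 2 * L * (F x1 - Fstar + 5 / L * K) + d * α := by
      field_simp
    rw [e1, e2] at h
    have hp1 : 0 ≤ 2 * L * s2 * T * (F x1 - Fstar + d * α / (2 * L)) := by positivity
    have hp2 : 0 ≤ 10 * s2 * T * K := by positivity
    have h3 : Real.sqrt (2 * L * s2 * T * (F x1 - Fstar + d * α / (2 * L)) + 10 * s2 * T * K)
        ≤ Real.sqrt (2 * L * s2 * T * (F x1 - Fstar + d * α / (2 * L)))
          + Real.sqrt (10 * s2 * T * K) := by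
      apply Real.sqrt_le_iff.2
      refine ⟨by positivity, ?_⟩
      rw [add_sq, Real.sq_sqrt hp1, Real.sq_sqrt hp2]
      have : 0 ≤ 2 * Real.sqrt (2 * L * s2 * T * (F x1 - Fstar + d * α / (2 * L)))
        * Real.sqrt (10 * s2 * T * K) := by positivity
      linarith
    linarith
  rw [hK5]
  constructor
  · intro j
    have h1 := hfinal (S j + α) (σ j ^ 2) (sq_nonneg _) (by
      have h2 := sg_quad L (F x1 - Fstar + 5 / L * K + d * α / (2 * L)) (S j + α)
        (S j + α + σ j ^ 2 * T) hL (by linarith [hS0 j])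
        (by have : 0 ≤ σ j ^ 2 * T := by positivity
            linarith) (by
        intro u hu0 hu2
        have h3 := hmain2 (Pi.single j u)
          (fun i => by by_cases h : i = j
                       · subst h; simpa using hu0
                       · simp [h])
          (fun i => by by_cases h : i = j
                       · subst h; simpa using hu2
                       · simp [h]; positivity)
        rw [Finset.sum_eq_single j (fun i _ h => by simp [h]) (by simp)] at h3
        simpa using h3)
      rwa [add_sub_cancel_left] at h2)
    linarith
  · have h1 := hfinal (∑ j, S j + d * α) (∑ j, σ j ^ 2)
      (Finset.sum_nonneg fun _ _ => sq_nonneg _) (by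
      have hX : 0 ≤ ∑ j, S j + d * α :=
        add_nonneg (Finset.sum_nonneg fun j _ => hS0 j) (by positivity)
      have hs : 0 ≤ (∑ j, σ j ^ 2) * T :=
        mul_nonneg (Finset.sum_nonneg fun _ _ => sq_nonneg _) hTpos.le
      have h2 := sg_quad L (F x1 - Fstar + 5 / L * K + d * α / (2 * L)) (∑ j, S j + d * α)
        (∑ j, S j + d * α + (∑ j, σ j ^ 2) * T) hL hX (by linarith) (by
        intro u hu0 hu2
        have h3 := hmain2 (fun _ => u) (fun _ => hu0) (fun _ => hu2)
        rw [Finset.sum_sub_distrib, ← Finset.mul_sum, ← Finset.mul_sum, Finset.sum_add_distrib,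
          Finset.sum_add_distrib, ← Finset.sum_mul] at h3
        simpa [Finset.sum_add_distrib] using h3)
      rwa [add_sub_cancel_left] at h2)
    linarith
end

section
/- Let F: ℝ^d → ℝ be L-smooth, satisfy the μ-PL condition with infimum F*, and consider SGD x_{t+1} = x_t − η_t g_t where, conditioned on the past, E[g_t] = ∇F(x_t) and E[‖g_t − ∇F(x_t)‖₂²] ≤ a‖∇F(x_t)‖₂² + b for constants a, b ≥ 0. Let T ≥ 3 be an integer, 1 ≤ β < T, and use the exponential step size η_t = η₀ α^t with η₀ = 1/(L(1+a)) and α = (β/T)^{1/T}. Then, with C(β) = exp(2μβ/(L(1+a)·ln(T/β))), E[F(x_{T+1})] − F* ≤ (5L·C(β)/(e²μ²))·(ln²(T/β)/T)·b + C(β)·exp(−(0.69μ/(L(1+a)))·(T/ln(T/β)))·(F(x₁) − F*). -/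
open MeasureTheory
open scoped BigOperators

theorem descent_aux {d : ℕ} (F : EuclideanSpace ℝ (Fin d) → ℝ) (L : ℝ)
    (hdiff : Differentiable ℝ F)
    (hsmooth : ∀ y z, ‖gradient F y - gradient F z‖ ≤ L * ‖y - z‖)
    (y v : EuclideanSpace ℝ (Fin d)) :
    F (y + v) ≤ F y + inner ℝ (gradient F y) v + L / 2 * ‖v‖ ^ 2 := by
  have hd : ∀ s : ℝ, HasDerivAt (fun s : ℝ => F (y + s • v) - s * inner ℝ (gradient F y) v
      - L / 2 * ‖v‖ ^ 2 * s ^ 2)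
      (inner ℝ (gradient F (y + s • v)) v - inner ℝ (gradient F y) v - L * ‖v‖ ^ 2 * s) s := by
    intro s
    have h1 : HasDerivAt (fun s : ℝ => y + s • v) v s := by
      simpa using ((hasDerivAt_id s).smul_const v).const_add y
    have h2 := (hdiff (y + s • v)).hasGradientAt.hasFDerivAt.comp_hasDerivAt s h1
    have h3 := (hasDerivAt_id s).mul_const (inner ℝ (gradient F y) v)
    have h4 := ((hasDerivAt_id s).pow 2).const_mul (L / 2 * ‖v‖ ^ 2)
    have h5 := (h2.sub h3).sub h4
    refine h5.congr_deriv ?_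
    simp
    ring
  have hanti : AntitoneOn (fun s : ℝ => F (y + s • v) - s * inner ℝ (gradient F y) v
      - L / 2 * ‖v‖ ^ 2 * s ^ 2) (Set.Icc 0 1) := by
    apply antitoneOn_of_deriv_nonpos (convex_Icc 0 1)
    · exact fun s _ => (hd s).continuousAt.continuousWithinAt
    · exact fun s _ => (hd s).differentiableAt.differentiableWithinAt
    · intro s hs
      rw [interior_Icc] at hs
      rw [(hd s).deriv, ← inner_sub_left]
      have h1 := real_inner_le_norm (gradient F (y + s • v) - gradient F y) v
      have h2 := hsmooth (y + s • v) y
      rw [add_sub_cancel_left, norm_smul, Real.norm_eq_abs, abs_of_pos hs.1] at h2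
      have h3 := mul_le_mul_of_nonneg_right h2 (norm_nonneg v)
      nlinarith
  have := hanti (show (0:ℝ) ∈ Set.Icc (0:ℝ) 1 by simp) (show (1:ℝ) ∈ Set.Icc (0:ℝ) 1 by simp)
    zero_le_one
  simp only [one_smul, zero_smul, add_zero] at this
  linarith

theorem step_aux {d : ℕ} {Ω : Type*} (m : MeasurableSpace Ω) [m0 : MeasurableSpace Ω]
    (μ : Measure Ω) [IsProbabilityMeasure μ] (hm : m ≤ m0)
    (F : EuclideanSpace ℝ (Fin d) → ℝ) (L μpl Fstar a b η : ℝ)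
    (hdiff : Differentiable ℝ F) (hL : 0 < L)
    (hη : 0 ≤ η) (hη2 : L * (1 + a) * η ≤ 1)
    (hsmooth : ∀ y z, ‖gradient F y - gradient F z‖ ≤ L * ‖y - z‖)
    (hPL : ∀ y, μpl * (F y - Fstar) ≤ 1 / 2 * ‖gradient F y‖ ^ 2)
    (x x' g : Ω → EuclideanSpace ℝ (Fin d))
    (hx : StronglyMeasurable[m] x) (hg : StronglyMeasurable g)
    (hunb : μ[g | m] =ᵐ[μ] fun ω => gradient F (x ω))
    (hvar : μ[(fun ω => ‖g ω - gradient F (x ω)‖ ^ 2) | m]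
        ≤ᵐ[μ] fun ω => a * ‖gradient F (x ω)‖ ^ 2 + b)
    (hupdate : ∀ ω, x' ω = x ω - η • g ω)
    (hF : Integrable (fun ω => F (x ω)) μ) (hF' : Integrable (fun ω => F (x' ω)) μ)
    (hG : Integrable (fun ω => ‖gradient F (x ω)‖ ^ 2) μ)
    (hg2 : Integrable (fun ω => ‖g ω‖ ^ 2) μ) :
    (∫ ω, F (x' ω) ∂μ) - Fstar ≤
      (1 - μpl * η) * ((∫ ω, F (x ω) ∂μ) - Fstar) + L / 2 * η ^ 2 * b := by
  have hcont : Continuous (gradient F) := by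
    have : LipschitzWith L.toNNReal (gradient F) := by
      apply LipschitzWith.of_dist_le_mul
      intro y z
      rw [dist_eq_norm, dist_eq_norm, Real.coe_toNNReal _ hL.le]
      exact hsmooth y z
    exact this.continuous
  have hu : StronglyMeasurable[m] (fun ω => gradient F (x ω)) :=
    hcont.comp_stronglyMeasurable hx
  have hu0 : StronglyMeasurable (fun ω => gradient F (x ω)) := hu.mono hm
  have hgi : Integrable g μ := by
    have := (memLp_two_iff_integrable_sq_norm hg.aestronglyMeasurable).2 hg2
    exact this.integrable (by norm_num)
  have hin : Integrable (fun ω => inner ℝ (gradient F (x ω)) (g ω)) μ := by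
    refine (hG.add hg2).mono' (hu0.inner hg).aestronglyMeasurable ?_
    refine Filter.Eventually.of_forall fun ω => ?_
    have h1 := norm_inner_le_norm (𝕜 := ℝ) (gradient F (x ω)) (g ω)
    simp only [Pi.add_apply]
    nlinarith [sq_nonneg (‖gradient F (x ω)‖ - ‖g ω‖), sq_nonneg (‖gradient F (x ω)‖),
      sq_nonneg (‖g ω‖)]
  have hinE : ∫ ω, inner ℝ (gradient F (x ω)) (g ω) ∂μ = ∫ ω, ‖gradient F (x ω)‖ ^ 2 ∂μ := by
    have h := condExp_bilin_of_stronglyMeasurable_left (μ := μ) (m := m) (innerSL ℝ)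
      (f := fun ω => gradient F (x ω)) (g := g) hu hin hgi
    rw [← integral_condExp hm]
    apply integral_congr_ae
    refine Filter.EventuallyEq.trans h ?_
    filter_upwards [hunb] with ω hω
    rw [hω, innerSL_apply_apply, real_inner_self_eq_norm_sq]
  have hv : ∀ ω, ‖g ω - gradient F (x ω)‖ ^ 2 =
      ‖g ω‖ ^ 2 - 2 * inner ℝ (gradient F (x ω)) (g ω) + ‖gradient F (x ω)‖ ^ 2 := by
    intro ω
    rw [norm_sub_sq_real, real_inner_comm]
  have hvE : ∫ ω, ‖g ω - gradient F (x ω)‖ ^ 2 ∂μ =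
      ∫ ω, ‖g ω‖ ^ 2 ∂μ - ∫ ω, ‖gradient F (x ω)‖ ^ 2 ∂μ := by
    simp_rw [hv]
    have hi : Integrable (fun ω => ‖g ω‖ ^ 2 - 2 * inner ℝ (gradient F (x ω)) (g ω)) μ :=
      hg2.sub (hin.const_mul 2)
    rw [integral_add hi hG, integral_sub hg2 (hin.const_mul 2),
      integral_const_mul, hinE]
    ring
  have hvB : ∫ ω, ‖g ω - gradient F (x ω)‖ ^ 2 ∂μ ≤ a * ∫ ω, ‖gradient F (x ω)‖ ^ 2 ∂μ + b := by
    rw [← integral_condExp hm]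
    refine (integral_mono_ae integrable_condExp ((hG.const_mul a).add (integrable_const b))
      hvar).trans_eq ?_
    simp only [Pi.add_apply]
    rw [integral_add (hG.const_mul a) (integrable_const b), integral_const_mul]
    simp
  have hpt : ∀ ω, F (x' ω) ≤ F (x ω) - η * inner ℝ (gradient F (x ω)) (g ω)
      + L / 2 * η ^ 2 * ‖g ω‖ ^ 2 := by
    intro ω
    have := descent_aux F L hdiff hsmooth (x ω) (-(η • g ω))
    rw [hupdate, sub_eq_add_neg]
    refine this.trans_eq ?_
    rw [inner_neg_right, real_inner_smul_right, norm_neg, norm_smul, mul_pow, Real.norm_eq_abs,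
      sq_abs]
    ring
  have hE : ∫ ω, F (x' ω) ∂μ ≤ ∫ ω, F (x ω) ∂μ - η * ∫ ω, ‖gradient F (x ω)‖ ^ 2 ∂μ
      + L / 2 * η ^ 2 * ∫ ω, ‖g ω‖ ^ 2 ∂μ := by
    refine (integral_mono hF' ((hF.sub (hin.const_mul η)).add
      (hg2.const_mul (L / 2 * η ^ 2))) hpt).trans_eq ?_
    simp only [Pi.add_apply, Pi.sub_apply]
    have hi : Integrable (fun ω => F (x ω) - η * inner ℝ (gradient F (x ω)) (g ω)) μ :=
      hF.sub (hin.const_mul η)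
    rw [integral_add hi (hg2.const_mul _),
      integral_sub hF (hin.const_mul η), integral_const_mul, integral_const_mul, hinE]
  have hPLE : μpl * ((∫ ω, F (x ω) ∂μ) - Fstar) ≤ 1 / 2 * ∫ ω, ‖gradient F (x ω)‖ ^ 2 ∂μ := by
    have := integral_mono ((hF.sub (integrable_const Fstar)).const_mul μpl)
      (hG.const_mul (1 / 2)) (fun ω => hPL (x ω))
    simp only [Pi.sub_apply] at this
    rw [integral_const_mul, integral_const_mul, integral_sub hF (integrable_const _)] at this
    simpa using this
  have hGn : 0 ≤ ∫ ω, ‖gradient F (x ω)‖ ^ 2 ∂μ := integral_nonneg fun ω => sq_nonneg _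
  set G := ∫ ω, ‖gradient F (x ω)‖ ^ 2 ∂μ
  set V := ∫ ω, ‖g ω‖ ^ 2 ∂μ
  have hV : V ≤ (1 + a) * G + b := by linarith
  have h1 : L / 2 * η ^ 2 * V ≤ L / 2 * η ^ 2 * ((1 + a) * G + b) :=
    mul_le_mul_of_nonneg_left hV (by positivity)
  have h2 : (L * (1 + a) * η) * (η * G) ≤ 1 * (η * G) :=
    mul_le_mul_of_nonneg_right hη2 (by positivity)
  have h3 := mul_le_mul_of_nonneg_left hPLE hη
  nlinarith

theorem exp_neg_aux (z : ℝ) (hz : 0 < z) :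
    Real.exp (-z) * (Real.exp 1 ^ 2 * z ^ 2) ≤ 4 := by
  have h1 : z / 2 ≤ Real.exp (z / 2 - 1) := by linarith [Real.add_one_le_exp (z / 2 - 1)]
  have h2 : Real.exp 1 * z ≤ 2 * Real.exp (z / 2) := by
    rw [Real.exp_sub, le_div_iff₀ (Real.exp_pos 1)] at h1
    linarith
  have h3 : (Real.exp 1 * z) ^ 2 ≤ (2 * Real.exp (z / 2)) ^ 2 :=
    pow_le_pow_left₀ (by positivity) h2 2
  have h4 : Real.exp (z / 2) ^ 2 = Real.exp z := by rw [← Real.exp_nat_mul]; congr 1; push_cast; ring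
  rw [mul_pow, mul_pow, h4] at h3
  rw [Real.exp_neg, inv_mul_le_iff₀ (Real.exp_pos z)]
  linarith

theorem w_aux (T : ℕ) (hT : 3 ≤ T) (β : ℝ) (hβ1 : 1 ≤ β) (hβT : β < T) :
    0.69 * (Real.exp (Real.log (T / β) / T) - 1) ≤ Real.log (T / β) / T := by
  have hT0 : (0:ℝ) < T := by linarith
  have hβ0 : 0 < β := by linarith
  have hl : 0 < Real.log (T / β) := Real.log_pos (by rw [lt_div_iff₀ hβ0]; linarith)
  set u := Real.log (T / β) / T with hu
  have hu0 : 0 < u := by positivity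
  have he := Real.exp_one_gt_d9
  have hu1 : u ≤ 0.368 := by
    rw [hu, div_le_iff₀ hT0]
    have h1 : Real.log (T / β) ≤ Real.log T :=
      Real.log_le_log (by positivity) (div_le_self hT0.le hβ1)
    have h2 : Real.log T ≤ T / Real.exp 1 := by
      have := Real.log_le_sub_one_of_pos (show 0 < T / Real.exp 1 by positivity)
      rw [Real.log_div hT0.ne' (Real.exp_pos 1).ne', Real.log_exp] at this
      linarith
    have h3 : T / Real.exp 1 ≤ 0.368 * T := by
      rw [div_le_iff₀ (Real.exp_pos 1)]
      nlinarith
    linarith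
  have := (abs_le.1 (Real.abs_exp_sub_one_sub_id_le (x := u)
    (by rw [abs_of_pos hu0]; linarith))).2
  nlinarith

/-- SGD with the exponential step size under the PL condition adapts to the noise. -/
theorem sgd_exponential_stepsize_pl {d : ℕ}
    {Ω : Type*} [m0 : MeasurableSpace Ω]
    (μ : Measure Ω) [IsProbabilityMeasure μ] (ℱ : Filtration ℕ m0)
    (F : EuclideanSpace ℝ (Fin d) → ℝ) (L μpl Fstar a b : ℝ)
    (hdiff : Differentiable ℝ F) (hL : 0 < L) (hμpl : 0 < μpl)
    (ha : 0 ≤ a) (hb : 0 ≤ b)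
    (hsmooth : ∀ y z, ‖gradient F y - gradient F z‖ ≤ L * ‖y - z‖)
    (hFstar : IsGLB (Set.range F) Fstar)
    (hPL : ∀ y, μpl * (F y - Fstar) ≤ 1 / 2 * ‖gradient F y‖ ^ 2)
    (T : ℕ) (hT : 3 ≤ T) (β : ℝ) (hβ1 : 1 ≤ β) (hβT : β < T)
    (x g : ℕ → Ω → EuclideanSpace ℝ (Fin d))
    (x1 : EuclideanSpace ℝ (Fin d)) (hx1 : ∀ ω, x 1 ω = x1)
    (hxmeas : ∀ t ∈ Finset.Icc 1 T, StronglyMeasurable[ℱ (t - 1)] (x t))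
    (hgmeas : ∀ t ∈ Finset.Icc 1 T, StronglyMeasurable[ℱ t] (g t))
    (hunb : ∀ t ∈ Finset.Icc 1 T,
      μ[g t | ℱ (t - 1)] =ᵐ[μ] fun ω => gradient F (x t ω))
    (hvar : ∀ t ∈ Finset.Icc 1 T,
      μ[(fun ω => ‖g t ω - gradient F (x t ω)‖ ^ 2) | ℱ (t - 1)]
        ≤ᵐ[μ] fun ω => a * ‖gradient F (x t ω)‖ ^ 2 + b)
    (hupdate : ∀ t ∈ Finset.Icc 1 T, ∀ ω,
      x (t + 1) ω = x t ω -
        ((1 / (L * (1 + a))) * ((β / T) ^ ((T : ℝ)⁻¹)) ^ t) • g t ω)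
    (hintF : ∀ t ∈ Finset.Icc 1 (T + 1), Integrable (fun ω => F (x t ω)) μ)
    (hintgrad : ∀ t ∈ Finset.Icc 1 T,
      Integrable (fun ω => ‖gradient F (x t ω)‖ ^ 2) μ)
    (hintg : ∀ t ∈ Finset.Icc 1 T, Integrable (fun ω => ‖g t ω‖ ^ 2) μ) :
    (∫ ω, F (x (T + 1) ω) ∂μ) - Fstar ≤
      5 * L * Real.exp (2 * μpl * β / (L * (1 + a) * Real.log (T / β))) /
          (Real.exp 1 ^ 2 * μpl ^ 2) * (Real.log (T / β) ^ 2 / T) * b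
      + Real.exp (2 * μpl * β / (L * (1 + a) * Real.log (T / β))) *
          Real.exp (-(0.69 * μpl / (L * (1 + a))) * (T / Real.log (T / β))) *
          (F x1 - Fstar) := by
  have hT0 : (0:ℝ) < T := by linarith
  have hβ0 : 0 < β := by linarith
  have hl : 0 < Real.log (T / β) := Real.log_pos (by rw [lt_div_iff₀ hβ0]; linarith)
  have hw69 := w_aux T hT β hβ1 hβT
  have hα : (β / T) ^ ((T : ℝ)⁻¹) = Real.exp (-(Real.log (T / β) / T)) := by
    rw [Real.rpow_def_of_pos (by positivity), ← inv_div, Real.log_inv]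
    congr 1
    ring
  have hαT : ((β / T) ^ ((T : ℝ)⁻¹)) ^ T = β / T :=
    Real.rpow_inv_natCast_pow (by positivity) (by omega)
  set ℓ := Real.log (T / β) with hℓ
  set α := (β / T) ^ ((T : ℝ)⁻¹) with hαdef
  set u := ℓ / T with hu
  have hu0 : 0 < u := by positivity
  obtain ⟨w, hw⟩ : ∃ w, w = Real.exp u - 1 := ⟨_, rfl⟩
  rw [← hw] at hw69
  have huw : u ≤ w := by linarith [Real.add_one_le_exp u]
  have hw0 : 0 < w := by linarith
  have hαw : α * (1 + w) = 1 := by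
    rw [hα, hw, add_sub_cancel, ← Real.exp_add]; simp
  have hα0 : 0 < α := by rw [hα]; positivity
  have hα1 : α ≤ 1 := by nlinarith
  have h1a : 0 < 1 + a := by linarith
  obtain ⟨η, hη⟩ : ∃ η, η = 1 / (L * (1 + a)) := ⟨_, rfl⟩
  have hη0 : 0 < η := by rw [hη]; positivity
  have hLη : L * (1 + a) * η = 1 := by rw [hη]; field_simp
  have hlow : ∀ y, Fstar ≤ F y := fun y => hFstar.1 ⟨y, rfl⟩
  obtain ⟨S, hS⟩ : ∃ S : ℕ → ℝ, S = fun t => μpl * η * α ^ t * (1 + w) / w := ⟨_, rfl⟩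
  have hSs : ∀ t, S (t + 1) = μpl * η * α ^ t / w := by
    intro t
    have : α ^ (t + 1) * (1 + w) = α ^ t := by rw [pow_succ, mul_assoc, hαw, mul_one]
    rw [hS]
    simp only
    rw [mul_assoc (μpl * η), this]
  have hSd : ∀ t, S t = S (t + 1) + μpl * (η * α ^ t) := by
    intro t
    rw [hSs, hS]
    field_simp
  obtain ⟨D, hD⟩ : ∃ D : ℕ → ℝ, D = fun t => (∫ ω, F (x t ω) ∂μ) - Fstar := ⟨_, rfl⟩
  have hD0 : ∀ t ∈ Finset.Icc 1 (T + 1), 0 ≤ D t := by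
    intro t ht
    rw [hD]
    have := integral_mono (integrable_const Fstar) (hintF t ht) (fun ω => hlow (x t ω))
    simp at this
    simpa using this
  obtain ⟨K, hK⟩ : ∃ K, K = L / 2 * b * (4 * w ^ 2 / (Real.exp 1 ^ 2 * μpl ^ 2)) := ⟨_, rfl⟩
  have hstep : ∀ t ∈ Finset.Icc 1 T,
      D (t + 1) * Real.exp (-S (t + 1)) ≤ D t * Real.exp (-S t) + K := by
    intro t ht
    have ht' := Finset.mem_Icc.1 ht
    have hmem : t ∈ Finset.Icc 1 (T + 1) := Finset.mem_Icc.2 ⟨ht'.1, by omega⟩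
    have hmem' : t + 1 ∈ Finset.Icc 1 (T + 1) := Finset.mem_Icc.2 ⟨by omega, by omega⟩
    have hp0 : 0 < α ^ t := by positivity
    have hp1 : α ^ t ≤ 1 := pow_le_one₀ hα0.le hα1
    have h := step_aux (ℱ (t - 1)) μ (ℱ.le _) F L μpl Fstar a b (η * α ^ t) hdiff hL
      (by positivity) (by rw [← mul_assoc, hLη, one_mul]; exact hp1) hsmooth hPL (x t) (x (t + 1))
      (g t) (hxmeas t ht) ((hgmeas t ht).mono (ℱ.le _)) (hunb t ht) (hvar t ht)
      (by rw [hη]; exact hupdate t ht) (hintF t hmem) (hintF _ hmem') (hintgrad t ht) (hintg t ht)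
    have h' : D (t + 1) ≤ Real.exp (-(μpl * (η * α ^ t))) * D t + L / 2 * (η * α ^ t) ^ 2 * b := by
      have e := mul_le_mul_of_nonneg_right (Real.add_one_le_exp (-(μpl * (η * α ^ t)))) (hD0 t hmem)
      have hDt : D t = (∫ ω, F (x t ω) ∂μ) - Fstar := by rw [hD]
      have hDt' : D (t + 1) = (∫ ω, F (x (t + 1) ω) ∂μ) - Fstar := by rw [hD]
      rw [← hDt, ← hDt'] at h
      linarith
    have h2 := mul_le_mul_of_nonneg_right h' (Real.exp_pos (-S (t + 1))).le
    have h3 : Real.exp (-(μpl * (η * α ^ t))) * Real.exp (-S (t + 1)) = Real.exp (-S t) := by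
      rw [← Real.exp_add, hSd t]; congr 1; ring
    have hSpos : 0 < S (t + 1) := by rw [hSs]; positivity
    have h4 : (η * α ^ t) ^ 2 * Real.exp (-S (t + 1)) ≤
        4 * w ^ 2 / (Real.exp 1 ^ 2 * μpl ^ 2) := by
      have h5 := exp_neg_aux _ hSpos
      have h6 : η * α ^ t = S (t + 1) * w / μpl := by rw [hSs]; field_simp
      rw [h6, le_div_iff₀ (by positivity)]
      have h7 := mul_le_mul_of_nonneg_right h5 (sq_nonneg w)
      refine le_trans (le_of_eq ?_) h7
      field_simp
    have h5 := mul_le_mul_of_nonneg_left h4 (show 0 ≤ L / 2 * b by positivity)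
    rw [← hK] at h5
    calc _ ≤ _ := h2
      _ = D t * (Real.exp (-(μpl * (η * α ^ t))) * Real.exp (-S (t + 1)))
          + L / 2 * b * ((η * α ^ t) ^ 2 * Real.exp (-S (t + 1))) := by ring
      _ ≤ _ := by rw [h3]; linarith
  have hind : ∀ n ≤ T, D (n + 1) * Real.exp (-S (n + 1)) ≤ D 1 * Real.exp (-S 1) + n * K := by
    intro n
    induction n with
    | zero => intro _; simp
    | succ n ih =>
      intro hn
      have h1 := ih (by omega)
      have h2 := hstep (n + 1) (Finset.mem_Icc.2 ⟨by omega, hn⟩)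
      push_cast
      linarith
  have hfin := hind T le_rfl
  have hD1 : D 1 = F x1 - Fstar := by rw [hD]; simp [hx1]
  have hST : S (T + 1) ≤ 2 * μpl * β / (L * (1 + a) * ℓ) := by
    have e1 : 2 * μpl * β / (L * (1 + a) * ℓ) = 2 * (μpl * η * (β / T) / u) := by
      rw [hη, hu]; field_simp
    rw [hSs, hαT, e1]
    have e2 : μpl * η * (β / T) / w ≤ μpl * η * (β / T) / u :=
      div_le_div_of_nonneg_left (by positivity) hu0 huw
    have e3 : 0 ≤ μpl * η * (β / T) / u := by positivity
    linarith
  have hS1 : -S 1 ≤ -(0.69 * μpl / (L * (1 + a))) * (T / ℓ) := by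
    have e1 : -(0.69 * μpl / (L * (1 + a))) * (T / ℓ) = -(μpl * η * (0.69 / u)) := by
      rw [hη, hu]; field_simp
    have e2 : S 1 = μpl * η * (1 / w) := by rw [hSs 0]; simp; ring
    have e3 : 0.69 / u ≤ 1 / w := by
      rw [div_le_div_iff₀ hu0 hw0]; linarith
    rw [e1, e2]
    exact neg_le_neg (mul_le_mul_of_nonneg_left e3 (by positivity))
  have hTK : T * K ≤ 5 * L / (Real.exp 1 ^ 2 * μpl ^ 2) * (ℓ ^ 2 / T) * b := by
    have e1 : ℓ ^ 2 / T = T * u ^ 2 := by rw [hu]; field_simp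
    have e2 : 2 * w ^ 2 ≤ 5 * u ^ 2 := by nlinarith
    have e3 := mul_le_mul_of_nonneg_left e2
      (show 0 ≤ T * L * b / (Real.exp 1 ^ 2 * μpl ^ 2) by positivity)
    rw [hK, e1]
    refine le_trans (le_of_eq ?_) (e3.trans (le_of_eq ?_)) <;> ring
  have hD1n : 0 ≤ D 1 := hD0 1 (Finset.mem_Icc.2 ⟨le_rfl, by omega⟩)
  have hDT : (∫ ω, F (x (T + 1) ω) ∂μ) - Fstar = D (T + 1) := by rw [hD]
  rw [hDT, ← hD1]
  set C := Real.exp (2 * μpl * β / (L * (1 + a) * ℓ)) with hC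
  have hCS : Real.exp (S (T + 1)) ≤ C := Real.exp_le_exp.2 hST
  have hE1 := mul_le_mul_of_nonneg_left (Real.exp_le_exp.2 hS1) hD1n
  set E := Real.exp (-(0.69 * μpl / (L * (1 + a))) * (T / ℓ))
  have hR : D (T + 1) * Real.exp (-S (T + 1)) ≤
      5 * L / (Real.exp 1 ^ 2 * μpl ^ 2) * (ℓ ^ 2 / T) * b + D 1 * E := by linarith
  have hR0 : 0 ≤ 5 * L / (Real.exp 1 ^ 2 * μpl ^ 2) * (ℓ ^ 2 / T) * b + D 1 * E := by positivity
  have hexp : Real.exp (-S (T + 1)) * Real.exp (S (T + 1)) = 1 := by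
    rw [← Real.exp_add]; simp
  calc D (T + 1) = D (T + 1) * Real.exp (-S (T + 1)) * Real.exp (S (T + 1)) := by
        rw [mul_assoc, hexp, mul_one]
    _ ≤ (5 * L / (Real.exp 1 ^ 2 * μpl ^ 2) * (ℓ ^ 2 / T) * b + D 1 * E) *
        Real.exp (S (T + 1)) := mul_le_mul_of_nonneg_right hR (Real.exp_pos _).le
    _ ≤ (5 * L / (Real.exp 1 ^ 2 * μpl ^ 2) * (ℓ ^ 2 / T) * b + D 1 * E) * C :=
        mul_le_mul_of_nonneg_left hCS hR0
    _ = _ := by ring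
end

section
/- Let F: ℝ^d → ℝ be differentiable, μ-strongly convex and L-smooth, with global minimizer x* (so ∇F(x*) = 0). Let K ⊂ ℝ^d be a product of closed bounded intervals with ‖x − y‖_∞ ≤ D_∞ for all x, y ∈ K, and suppose x* ∈ K. Run per-coordinate AdaGrad on K for T steps from x₁ ∈ K: η_{t,j} = η/√(Σ_{i=1}^t (∂_j F(x_i))²) with η = D_∞/√2 (assuming these sums are positive), x_{t+1} = Π_K(x_t − η_t ∘ ∇F(x_t)), and let x̄ = (1/T)Σ_{t=1}^T x_t. Then ‖x̄ − x*‖_∞² ≤ 8 L d D_∞²/(μ T). In particular, if T = 32 d L/μ then ‖x̄ − x*‖_∞² ≤ D_∞²/4. -/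
open scoped BigOperators

lemma ag_scalar (D : ℝ) (hD : 0 ≤ D) (T : ℕ) (a g : ℕ → ℝ)
    (hpos : ∀ t ∈ Finset.Icc 1 T, 0 < ∑ i ∈ Finset.Icc 1 t, g i ^ 2)
    (ha : ∀ t, 1 ≤ t → t ≤ T + 1 → |a t| ≤ D)
    (hstep : ∀ t ∈ Finset.Icc 1 T, a (t+1) ^ 2 ≤
      (a t - (D / √2) / √(∑ i ∈ Finset.Icc 1 t, g i ^ 2) * g t) ^ 2) :
    ∑ t ∈ Finset.Icc 1 T, g t * a t ≤ √2 * D * √(∑ i ∈ Finset.Icc 1 T, g i ^ 2) := by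
  have h2 : √2 * √2 = (2:ℝ) := Real.mul_self_sqrt (by norm_num)
  have h2p : 0 < √(2:ℝ) := by positivity
  have key : ∀ n ≤ T, √2 * D * ∑ t ∈ Finset.Icc 1 n, g t * a t ≤
      √(∑ i ∈ Finset.Icc 1 n, g i ^ 2) * (2 * D^2 - a (n+1) ^ 2) := by
    intro n
    induction n with
    | zero => intro _; simp
    | succ n ih =>
      intro hn
      have ih := ih (by omega)
      have hmem : n + 1 ∈ Finset.Icc 1 T := by simp; omega
      have hp := hpos _ hmem
      have hs := hstep _ hmem
      have hsum : ∑ i ∈ Finset.Icc 1 (n+1), g i ^ 2 = ∑ i ∈ Finset.Icc 1 n, g i ^ 2 + g (n+1)^2 :=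
        Finset.sum_Icc_succ_top (by omega) _
      rw [Finset.sum_Icc_succ_top (by omega)]
      have hB0 : 0 ≤ ∑ i ∈ Finset.Icc 1 n, g i ^ 2 := Finset.sum_nonneg fun i _ => sq_nonneg _
      have hA2 := Real.sq_sqrt hp.le
      have hB2 := Real.sq_sqrt hB0
      have hApos := Real.sqrt_pos.2 hp
      have hBnn := Real.sqrt_nonneg (∑ i ∈ Finset.Icc 1 n, g i ^ 2)
      have haD : a (n+1) ^ 2 ≤ D^2 := by
        have := ha (n+1) (by omega) (by omega)
        exact sq_le_sq' (by linarith [(abs_le.1 this).1]) (abs_le.1 this).2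
      set A := √(∑ i ∈ Finset.Icc 1 (n+1), g i ^ 2)
      set B := √(∑ i ∈ Finset.Icc 1 n, g i ^ 2)
      set S := ∑ t ∈ Finset.Icc 1 n, g t * a t
      have hg : g (n+1)^2 = A^2 - B^2 := by rw [hA2, hB2, hsum]; ring
      have hBA : B ≤ A := by
        apply Real.sqrt_le_sqrt; rw [hsum]; nlinarith [sq_nonneg (g (n+1))]
      generalize g (n+1) = γ at *
      generalize a (n+1+1) = c at *
      generalize a (n+1) = b at *
      have e1 : (b - D / √2 / A * γ)^2 * A = A * b^2 - √2 * D * (γ * b) + D^2/2 * (γ^2 / A) := by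
        have : D / √2 = √2 * D / 2 := by
          rw [div_eq_div_iff h2p.ne' two_ne_zero]; linear_combination (-D) * h2
        rw [this]; field_simp
        linear_combination (D^2*γ^2) * h2
      have e2 : γ^2 / A ≤ 2 * (A - B) := by
        rw [div_le_iff₀ hApos, hg]; nlinarith [sq_nonneg (A-B)]
      have e3 := mul_le_mul_of_nonneg_right hs hApos.le
      rw [e1] at e3
      have e4 := mul_le_mul_of_nonneg_left e2 (by positivity : 0 ≤ D^2/2)
      have e5 := mul_nonneg (sub_nonneg.2 hBA) (sub_nonneg.2 haD)
      nlinarith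
  rcases hD.eq_or_lt with h0 | h0
  · subst h0
    have : ∑ t ∈ Finset.Icc 1 T, g t * a t = 0 := by
      apply Finset.sum_eq_zero
      intro t ht
      simp only [Finset.mem_Icc] at ht
      have := abs_eq_zero.1 (le_antisymm (ha t ht.1 (by omega)) (abs_nonneg _))
      simp [this]
    simp [this]
  · have k := key T le_rfl
    have hS := Real.sqrt_nonneg (∑ i ∈ Finset.Icc 1 T, g i ^ 2)
    have : √2 * D * ∑ t ∈ Finset.Icc 1 T, g t * a t ≤
        √2 * D * (√2 * D * √(∑ i ∈ Finset.Icc 1 T, g i ^ 2)) := by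
      have e : √2 * D * (√2 * D * √(∑ i ∈ Finset.Icc 1 T, g i ^ 2))
        = 2 * D^2 * √(∑ i ∈ Finset.Icc 1 T, g i ^ 2) := by
          linear_combination (D^2 * √(∑ i ∈ Finset.Icc 1 T, g i ^ 2)) * h2
      rw [e]
      nlinarith [mul_nonneg hS (sq_nonneg (a (T+1)))]
    exact le_of_mul_le_mul_left this (by positivity)

lemma ag_clip (lo hi p c z : ℝ) (hp : p ∈ Set.Icc lo hi) (hc : c ∈ Set.Icc lo hi)
    (h : ∀ u ∈ Set.Icc lo hi, (p - z)^2 ≤ (u - z)^2) : (p - c)^2 ≤ (z - c)^2 := by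
  obtain ⟨p1, p2⟩ := hp
  obtain ⟨c1, c2⟩ := hc
  by_cases h1 : z < lo
  · have := h lo ⟨le_rfl, by linarith⟩
    have : p = lo := by nlinarith
    subst this; nlinarith
  · by_cases h2 : hi < z
    · have := h hi ⟨by linarith, le_rfl⟩
      have : p = hi := by nlinarith
      subst this; nlinarith
    · have := h z ⟨by linarith, by linarith⟩
      have : p = z := by nlinarith [sq_nonneg (p - z)]
      rw [this]

lemma ag_proj {d : ℕ} (lo hi : Fin d → ℝ) (p z c : EuclideanSpace ℝ (Fin d))
    (hp : ∀ j, p j ∈ Set.Icc (lo j) (hi j)) (hc : ∀ j, c j ∈ Set.Icc (lo j) (hi j))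
    (h : ∀ y : EuclideanSpace ℝ (Fin d), (∀ j, y j ∈ Set.Icc (lo j) (hi j)) → ‖p - z‖ ≤ ‖y - z‖)
    (j : Fin d) : (p j - c j)^2 ≤ (z j - c j)^2 := by
  apply ag_clip (lo j) (hi j) _ _ _ (hp j) (hc j)
  intro u hu
  have := h (WithLp.toLp 2 (Function.update (fun i => p i) j u)) (by
    intro i
    by_cases hij : i = j
    · subst hij; simpa using hu
    · simpa [Function.update_of_ne hij] using hp i)
  have h2 := pow_le_pow_left₀ (norm_nonneg _) this 2
  rw [EuclideanSpace.real_norm_sq_eq, EuclideanSpace.real_norm_sq_eq] at h2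
  rw [← Finset.add_sum_erase _ _ (Finset.mem_univ j), ← Finset.add_sum_erase _ _ (Finset.mem_univ j)] at h2
  have e : ∀ i ∈ Finset.univ.erase j, ((WithLp.toLp 2 (Function.update (fun i => p i) j u) - z : EuclideanSpace ℝ (Fin d)) i)^2 = ((p - z) i)^2 := by
    intro i hi
    simp [Function.update_of_ne (Finset.ne_of_mem_erase hi)]
  rw [Finset.sum_congr rfl e] at h2
  have h3 := le_of_add_le_add_right h2
  simpa using h3

section
variable {E : Type*} [NormedAddCommGroup E] [InnerProductSpace ℝ E] [CompleteSpace E]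

lemma ag_line (F : E → ℝ) (hdiff : Differentiable ℝ F) (y v : E) (s : ℝ) :
    HasDerivAt (fun s : ℝ => F (y + s • v)) (inner ℝ (gradient F (y + s • v)) v) s := by
  have h1 := (hdiff (y + s • v)).hasGradientAt.hasFDerivAt
  have h2 : HasDerivAt (fun s : ℝ => y + s • v) v s := by
    simpa using ((hasDerivAt_id s).smul_const v).const_add y
  have h3 := h1.comp_hasDerivAt s h2
  rw [InnerProductSpace.toDual_apply_apply] at h3
  exact h3

lemma ag_descent (F : E → ℝ) (L : ℝ) (hdiff : Differentiable ℝ F)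
    (hsmooth : ∀ y z, ‖gradient F y - gradient F z‖ ≤ L * ‖y - z‖) (y v : E) :
    F (y + v) ≤ F y + inner ℝ (gradient F y) v + L / 2 * ‖v‖^2 := by
  have hd : ∀ s : ℝ, HasDerivAt (fun s : ℝ => F (y + s • v) - s * inner ℝ (gradient F y) v
      - s^2 * (L/2 * ‖v‖^2))
      (inner ℝ (gradient F (y + s • v)) v - inner ℝ (gradient F y) v - 2 * s * (L/2*‖v‖^2)) s := by
    intro s
    have := ((ag_line F hdiff y v s).sub ((hasDerivAt_id s).mul_const (inner ℝ (gradient F y) v))).sub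
      ((hasDerivAt_pow 2 s).mul_const (L/2 * ‖v‖^2))
    refine HasDerivAt.congr_deriv this ?_
    simp
  have hanti : AntitoneOn (fun s : ℝ => F (y + s • v) - s * inner ℝ (gradient F y) v
      - s^2 * (L/2 * ‖v‖^2)) (Set.Ici 0) := by
    apply antitoneOn_of_deriv_nonpos (convex_Ici 0)
    · exact fun s _ => (hd s).continuousAt.continuousWithinAt
    · exact fun s _ => (hd s).differentiableAt.differentiableWithinAt
    · intro s hs
      rw [interior_Ici] at hs
      have hs : 0 < s := hs
      rw [(hd s).deriv, ← inner_sub_left]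
      have h1 := real_inner_le_norm (gradient F (y + s • v) - gradient F y) v
      have h2 := hsmooth (y + s • v) y
      rw [add_sub_cancel_left, norm_smul, Real.norm_of_nonneg hs.le] at h2
      have h3 := mul_le_mul_of_nonneg_right h2 (norm_nonneg v)
      nlinarith
  have := hanti (by simp : (0:ℝ) ∈ Set.Ici 0) (by simp : (1:ℝ) ∈ Set.Ici 0) zero_le_one
  simp only [one_smul, zero_smul, add_zero, one_mul, zero_mul, one_pow, ne_eq, OfNat.ofNat_ne_zero, not_false_eq_true, zero_pow, sub_zero] at this
  linarith

lemma ag_grad_sq (F : E → ℝ) (L : ℝ) (hL : 0 < L) (hdiff : Differentiable ℝ F)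
    (hsmooth : ∀ y z, ‖gradient F y - gradient F z‖ ≤ L * ‖y - z‖) (xs : E)
    (hmin : ∀ y, F xs ≤ F y) (y : E) :
    ‖gradient F y‖^2 ≤ 2 * L * (F y - F xs) := by
  have h := ag_descent F L hdiff hsmooth y (-(L⁻¹) • gradient F y)
  have h' := hmin (y + -(L⁻¹) • gradient F y)
  rw [inner_smul_right, real_inner_self_eq_norm_sq, norm_smul, norm_neg, Real.norm_of_nonneg (by positivity)] at h
  have e : -L⁻¹ * ‖gradient F y‖^2 + L/2 * (L⁻¹ * ‖gradient F y‖)^2 = - (‖gradient F y‖^2 / (2*L)) := by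
    field_simp; ring
  have : ‖gradient F y‖^2 / (2*L) ≤ F y - F xs := by linarith
  rw [div_le_iff₀ (by positivity)] at this
  linarith

lemma ag_convex (F : E → ℝ) (m : ℝ) (hm : 0 < m)
    (hsc : ∀ y z : E, ∀ θ : ℝ, 0 ≤ θ → θ ≤ 1 →
      F (θ • y + (1 - θ) • z) ≤
        θ * F y + (1 - θ) * F z - m / 2 * θ * (1 - θ) * ‖y - z‖ ^ 2) :
    ConvexOn ℝ Set.univ F := by
  refine ⟨convex_univ, fun y _ z _ a b ha hb hab => ?_⟩
  obtain rfl : b = 1 - a := by linarith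
  have := hsc y z a ha (by linarith)
  have h2 : 0 ≤ m / 2 * a * (1 - a) * ‖y - z‖ ^ 2 := by positivity
  simp only [smul_eq_mul]; linarith

lemma ag_first (F : E → ℝ) (hdiff : Differentiable ℝ F) (hc : ConvexOn ℝ Set.univ F) (y z : E) :
    F y - F z ≤ inner ℝ (gradient F y) (y - z) := by
  have h : ConvexOn ℝ Set.univ (fun s : ℝ => F (y + s • (z - y))) := by
    refine ⟨convex_univ, fun s _ t _ a b ha hb hab => ?_⟩
    have := hc.2 (Set.mem_univ (y + s • (z - y))) (Set.mem_univ (y + t • (z - y))) ha hb hab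
    have e : y + (a • s + b • t) • (z - y) = a • (y + s • (z - y)) + b • (y + t • (z - y)) := by
      obtain rfl : b = 1 - a := by linarith
      simp only [smul_eq_mul]; module
    simp only [e]; exact this
  have hd := ag_line F hdiff y (z - y) 0
  have := h.le_slope_of_hasDerivAt (Set.mem_univ 0) (Set.mem_univ 1) zero_lt_one hd
  simp only [slope_def_field, zero_smul, add_zero, one_smul, sub_zero, div_one, add_sub_cancel] at this
  rw [← neg_sub z y, inner_neg_right]; linarith

lemma ag_growth (F : E → ℝ) (m : ℝ)
    (hsc : ∀ y z : E, ∀ θ : ℝ, 0 ≤ θ → θ ≤ 1 →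
      F (θ • y + (1 - θ) • z) ≤
        θ * F y + (1 - θ) * F z - m / 2 * θ * (1 - θ) * ‖y - z‖ ^ 2) (xs : E)
    (hmin : ∀ y, F xs ≤ F y) (y : E) : m / 2 * ‖y - xs‖^2 ≤ F y - F xs := by
  have h : ∀ θ ∈ Set.Ioo (0:ℝ) 1, m / 2 * (1 - θ) * ‖y - xs‖^2 ≤ F y - F xs := by
    intro θ hθ
    have h1 := hsc y xs θ hθ.1.le hθ.2.le
    have h2 := hmin (θ • y + (1 - θ) • xs)
    refine le_of_mul_le_mul_left ?_ hθ.1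
    linarith
  have ht : Filter.Tendsto (fun θ : ℝ => m / 2 * (1 - θ) * ‖y - xs‖^2) (nhdsWithin 0 (Set.Ioi 0))
      (nhds (m / 2 * ‖y - xs‖^2)) := by
    have : Continuous (fun θ : ℝ => m / 2 * (1 - θ) * ‖y - xs‖^2) := by fun_prop
    simpa using (this.tendsto 0).mono_left nhdsWithin_le_nhds
  refine le_of_tendsto ht ?_
  filter_upwards [Ioo_mem_nhdsGT (zero_lt_one' ℝ)] with θ hθ using h θ hθ
end

/-- Per-coordinate AdaGrad on a hypercube for a strongly convex and smooth function:
the averaged iterate contracts towards the minimizer in the sup norm. -/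
theorem adagrad_per_coordinate_strongly_convex_contraction {d : ℕ} (hd : 0 < d)
    (F : EuclideanSpace ℝ (Fin d) → ℝ) (L μpl : ℝ)
    (hdiff : Differentiable ℝ F) (hL : 0 < L) (hμpl : 0 < μpl)
    (hsmooth : ∀ y z, ‖gradient F y - gradient F z‖ ≤ L * ‖y - z‖)
    (hsc : ∀ y z : EuclideanSpace ℝ (Fin d), ∀ θ : ℝ, 0 ≤ θ → θ ≤ 1 →
      F (θ • y + (1 - θ) • z) ≤
        θ * F y + (1 - θ) * F z - μpl / 2 * θ * (1 - θ) * ‖y - z‖ ^ 2)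
    (xstar : EuclideanSpace ℝ (Fin d))
    (hmin : ∀ y, F xstar ≤ F y) (hgradstar : gradient F xstar = 0)
    (lo hi : Fin d → ℝ) (K : Set (EuclideanSpace ℝ (Fin d)))
    (hK : K = {z : EuclideanSpace ℝ (Fin d) | ∀ j, z j ∈ Set.Icc (lo j) (hi j)})
    (hxstarK : xstar ∈ K)
    (Dinf : ℝ)
    (hDinf : ∀ y ∈ K, ∀ z ∈ K, ∀ j, |y j - z j| ≤ Dinf)
    (proj : EuclideanSpace ℝ (Fin d) → EuclideanSpace ℝ (Fin d))
    (hprojmem : ∀ z, proj z ∈ K)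
    (hproj : ∀ z, ∀ y ∈ K, ‖proj z - z‖ ≤ ‖y - z‖)
    (T : ℕ) (hT : 1 ≤ T)
    (x : ℕ → EuclideanSpace ℝ (Fin d)) (hx1 : x 1 ∈ K)
    (hpos : ∀ t ∈ Finset.Icc 1 T, ∀ j,
      0 < ∑ i ∈ Finset.Icc 1 t, (gradient F (x i) j) ^ 2)
    (hupdate : ∀ t ∈ Finset.Icc 1 T,
      x (t + 1) = proj ((EuclideanSpace.equiv (Fin d) ℝ).symm (fun j =>
        x t j - (Dinf / Real.sqrt 2) /
            Real.sqrt (∑ i ∈ Finset.Icc 1 t, (gradient F (x i) j) ^ 2) *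
          gradient F (x t) j))) :
    ‖EuclideanSpace.equiv (Fin d) ℝ
        (((T : ℝ)⁻¹ • ∑ t ∈ Finset.Icc 1 T, x t) - xstar)‖ ^ 2 ≤
      8 * L * d * Dinf ^ 2 / (μpl * T) ∧
    ((T : ℝ) = 32 * d * L / μpl →
      ‖EuclideanSpace.equiv (Fin d) ℝ
          (((T : ℝ)⁻¹ • ∑ t ∈ Finset.Icc 1 T, x t) - xstar)‖ ^ 2 ≤ Dinf ^ 2 / 4) := by
  have hD : 0 ≤ Dinf := (abs_nonneg _).trans (hDinf _ hxstarK _ hxstarK ⟨0, hd⟩)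
  have hTpos : (0:ℝ) < T := by exact_mod_cast hT
  have hdpos : (0:ℝ) < d := by exact_mod_cast hd
  have hxK : ∀ t, 1 ≤ t → t ≤ T + 1 → x t ∈ K := by
    intro t h1 h2
    rcases Nat.lt_or_ge 1 t with h | h
    · obtain ⟨s, rfl⟩ : ∃ s, t = s + 1 := ⟨t - 1, by omega⟩
      rw [hupdate s (by simp; omega)]; exact hprojmem _
    · obtain rfl : t = 1 := by omega
      exact hx1
  have hreg : ∀ j, ∑ t ∈ Finset.Icc 1 T, gradient F (x t) j * (x t j - xstar j) ≤
      √2 * Dinf * √(∑ i ∈ Finset.Icc 1 T, (gradient F (x i) j) ^ 2) := by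
    intro j
    apply ag_scalar Dinf hD T (fun t => x t j - xstar j) (fun t => gradient F (x t) j)
    · exact fun t ht => hpos t ht j
    · exact fun t h1 h2 => hDinf _ (hxK t h1 h2) _ hxstarK j
    · intro t ht
      have hu := hupdate t ht
      set z : EuclideanSpace ℝ (Fin d) := (EuclideanSpace.equiv (Fin d) ℝ).symm (fun j =>
        x t j - (Dinf / Real.sqrt 2) /
            Real.sqrt (∑ i ∈ Finset.Icc 1 t, (gradient F (x i) j) ^ 2) *
          gradient F (x t) j) with hz
      have hm := hprojmem z
      have hcs := hxstarK
      rw [hK] at hm hcs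
      have := ag_proj lo hi (proj z) z xstar hm hcs
        (fun y hy => hproj z y (by rw [hK]; exact hy)) j
      rw [← hu] at this
      refine this.trans (le_of_eq ?_)
      have : z j = x t j - (Dinf / Real.sqrt 2) /
            Real.sqrt (∑ i ∈ Finset.Icc 1 t, (gradient F (x i) j) ^ 2) *
          gradient F (x t) j := rfl
      rw [this]; ring
  have hconv := ag_convex F μpl hμpl hsc
  set R := ∑ t ∈ Finset.Icc 1 T, (F (x t) - F xstar) with hR
  have hR0 : 0 ≤ R := Finset.sum_nonneg fun t _ => sub_nonneg.2 (hmin _)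
  set S : Fin d → ℝ := fun j => √(∑ i ∈ Finset.Icc 1 T, (gradient F (x i) j) ^ 2) with hS
  have hR1 : R ≤ √2 * Dinf * ∑ j, S j := by
    calc R ≤ ∑ t ∈ Finset.Icc 1 T, inner ℝ (gradient F (x t)) (x t - xstar) :=
          Finset.sum_le_sum fun t _ => ag_first F hdiff hconv _ _
      _ = ∑ j, ∑ t ∈ Finset.Icc 1 T, gradient F (x t) j * (x t j - xstar j) := by
          rw [Finset.sum_comm]
          refine Finset.sum_congr rfl fun t _ => ?_
          rw [PiLp.inner_apply]
          exact Finset.sum_congr rfl fun j _ => by simp [mul_comm]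
      _ ≤ ∑ j, √2 * Dinf * S j := Finset.sum_le_sum fun j _ => hreg j
      _ = _ := by rw [Finset.mul_sum]
  have hS2 : (∑ j, S j)^2 ≤ d * (2 * L * R) := by
    have h1 : (∑ j, S j)^2 ≤ d * ∑ j, (S j)^2 := by
      simpa using sq_sum_le_card_mul_sum_sq (s := Finset.univ) (f := S)
    have h2 : ∑ j, (S j)^2 ≤ 2 * L * R := by
      calc ∑ j, (S j)^2 = ∑ j, ∑ i ∈ Finset.Icc 1 T, (gradient F (x i) j) ^ 2 :=
            Finset.sum_congr rfl fun j _ => Real.sq_sqrt (Finset.sum_nonneg fun i _ => sq_nonneg _)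
        _ = ∑ i ∈ Finset.Icc 1 T, ‖gradient F (x i)‖^2 := by
            rw [Finset.sum_comm]
            exact Finset.sum_congr rfl fun i _ => (EuclideanSpace.real_norm_sq_eq _).symm
        _ ≤ ∑ i ∈ Finset.Icc 1 T, 2 * L * (F (x i) - F xstar) :=
            Finset.sum_le_sum fun i _ => ag_grad_sq F L hL hdiff hsmooth xstar hmin _
        _ = _ := by rw [← Finset.mul_sum]
    exact h1.trans (mul_le_mul_of_nonneg_left h2 hdpos.le)
  have hR2 : R ≤ 4 * L * d * Dinf^2 := by
    rcases hR0.eq_or_lt with h | h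
    · rw [← h]; positivity
    · have h1 := pow_le_pow_left₀ hR0 hR1 2
      have h2 : (√2 * Dinf * ∑ j, S j)^2 = 2 * Dinf^2 * (∑ j, S j)^2 := by
        rw [mul_pow, mul_pow, Real.sq_sqrt (by norm_num)]
      have h3 := mul_le_mul_of_nonneg_left hS2 (by positivity : 0 ≤ 2 * Dinf^2)
      refine le_of_mul_le_mul_left ?_ h
      nlinarith
  set xb := (T : ℝ)⁻¹ • ∑ t ∈ Finset.Icc 1 T, x t with hxb
  have hJ : F xb - F xstar ≤ R / T := by
    have := hconv.map_sum_le (t := Finset.Icc 1 T) (w := fun _ => (T:ℝ)⁻¹) (p := x)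
      (fun _ _ => by positivity) (by simp [hTpos.ne']) (fun _ _ => Set.mem_univ _)
    rw [← Finset.smul_sum, ← Finset.smul_sum, ← hxb, smul_eq_mul] at this
    have e : R / T = (T:ℝ)⁻¹ * ∑ t ∈ Finset.Icc 1 T, F (x t) - F xstar := by
      rw [hR, Finset.sum_sub_distrib]; simp; field_simp
    linarith
  have hg := ag_growth F μpl hsc xstar hmin xb
  have hn : ‖EuclideanSpace.equiv (Fin d) ℝ (xb - xstar)‖ ≤ ‖xb - xstar‖ :=
    (pi_norm_le_iff_of_nonneg (norm_nonneg _)).2 fun j => PiLp.norm_apply_le (xb - xstar) j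
  have hn2 := pow_le_pow_left₀ (norm_nonneg _) hn 2
  have main : ‖EuclideanSpace.equiv (Fin d) ℝ (xb - xstar)‖ ^ 2 ≤
      8 * L * d * Dinf ^ 2 / (μpl * T) := by
    refine hn2.trans ?_
    rw [le_div_iff₀ (by positivity)]
    have h1 : μpl / 2 * ‖xb - xstar‖^2 ≤ R / T := hg.trans hJ
    rw [le_div_iff₀ hTpos] at h1
    linarith
  refine ⟨main, fun hTe => main.trans (le_of_eq ?_)⟩
  rw [hTe]
  field_simp
  ring
end
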